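/- arXiv:2309.01800 — 4 statements merged into one kernel-verified Lean document; each statement's English description precedes it below -/
import Mathlib

section
/- For all integers q ≥ 3, 1 ≤ ℓ < q and L > ℓ with L ≥ 2, the constant c_{q,ℓ,L} := q^{−L} ∑_{a∈A_{q,L}} (maxℓ{a}/L) · multinom(L; a_1,...,a_q) · [∑_{i=1}^q C(a_i,2) − (1/q)·C(L,2)] is strictly positive, where A_{q,L} = {(a_1,...,a_q) ∈ ℤ_{≥0}^q : a_1+⋯+a_q = L}, maxℓ{a} = max_{A ⊆ [q], |A|=ℓ} ∑_{i∈A} a_i, multinom(L; a_1,...,a_q) = L!/(a_1!⋯a_q!), and C(a,2) = a(a−1)/2. -/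
open Finset

/-- `maxl q ℓ a`: the sum of the `ℓ` largest entries of `a`, i.e.
`max_{A ⊆ [q], |A|=ℓ} ∑_{i∈A} a i`. -/
def maxl (q ℓ : ℕ) (a : Fin q → ℕ) : ℕ :=
  (Finset.powersetCard ℓ (Finset.univ : Finset (Fin q))).sup fun A => ∑ i ∈ A, a i

lemma maxl_le_iff (q ℓ : ℕ) (a : Fin q → ℕ) (K : ℕ) :
    maxl q ℓ a ≤ K ↔ ∀ A : Finset (Fin q), A.card = ℓ → ∑ i ∈ A, a i ≤ K := by
  unfold maxl
  rw [Finset.sup_le_iff]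
  simp [Finset.mem_powersetCard]

lemma le_maxl (q ℓ : ℕ) (a : Fin q → ℕ) (A : Finset (Fin q)) (hA : A.card = ℓ) :
    ∑ i ∈ A, a i ≤ maxl q ℓ a :=
  (maxl_le_iff q ℓ a _).1 le_rfl A hA

lemma maxl_convex (q ℓ : ℕ) (c u v : Fin q → ℕ) :
    2 * maxl q ℓ (c + u + v) ≤ maxl q ℓ (c + u + u) + maxl q ℓ (c + v + v) := by
  have h : maxl q ℓ (c + u + v) ≤ (maxl q ℓ (c + u + u) + maxl q ℓ (c + v + v)) / 2 := by
    rw [maxl_le_iff]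
    intro A hA
    have h1 := le_maxl q ℓ (c + u + u) A hA
    have h2 := le_maxl q ℓ (c + v + v) A hA
    simp only [Pi.add_apply, Finset.sum_add_distrib] at h1 h2 ⊢
    omega
  omega

lemma multinomial_step (q n : ℕ) (i : Fin q) (b : Fin q → ℕ) (hb : ∑ k, b k = n) :
    Nat.multinomial univ (b + Pi.single i 1) * (b i + 1) = (n + 1) * Nat.multinomial univ b := by
  have h1 := Nat.multinomial_spec univ b
  have h2 := Nat.multinomial_spec univ (b + Pi.single i 1)
  have hs : ∑ k, (b + Pi.single i 1 : Fin q → ℕ) k = n + 1 := by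
    simp [Finset.sum_add_distrib, hb]
  have hp : ∏ k, ((b + Pi.single i 1 : Fin q → ℕ) k).factorial = (b i + 1) * ∏ k, (b k).factorial := by
    rw [← Finset.mul_prod_erase univ _ (Finset.mem_univ i),
      ← Finset.mul_prod_erase univ (fun k => (b k).factorial) (Finset.mem_univ i), ← mul_assoc]
    congr 1
    · simp [Nat.factorial_succ]
    · apply Finset.prod_congr rfl
      intro k hk
      have : k ≠ i := Finset.ne_of_mem_erase hk
      simp [this]
  rw [hs, hp, Nat.factorial_succ] at h2
  rw [hb] at h1
  have hpos : 0 < ∏ k, (b k).factorial := Finset.prod_pos fun k _ => Nat.factorial_pos _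
  apply Nat.eq_of_mul_eq_mul_left hpos
  rw [← h1] at h2
  linarith

lemma sum_step (q n : ℕ) (i : Fin q) (g : (Fin q → ℕ) → ℝ) :
    ∑ a ∈ Finset.Nat.antidiagonalTuple q (n + 1),
      (Nat.multinomial univ a : ℝ) * (a i : ℝ) * g a
    = ((n : ℝ) + 1) * ∑ b ∈ Finset.Nat.antidiagonalTuple q n,
      (Nat.multinomial univ b : ℝ) * g (b + Pi.single i 1) := by
  rw [Finset.mul_sum]
  symm
  apply Finset.sum_of_injOn (fun b => b + Pi.single i 1)
  · intro a _ b _ h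
    exact add_right_cancel h
  · intro b hb
    simp only [Finset.mem_coe, Finset.Nat.mem_antidiagonalTuple] at hb ⊢
    simp [Finset.sum_add_distrib, hb]
  · intro a ha hn
    rw [Finset.Nat.mem_antidiagonalTuple] at ha
    have : a i = 0 := by
      by_contra h0
      apply hn
      have hle : (Pi.single i 1 : Fin q → ℕ) ≤ a := by
        intro k
        by_cases hk : k = i
        · subst hk; simp; omega
        · simp [hk]
      refine ⟨a - Pi.single i 1, ?_, tsub_add_cancel_of_le hle⟩
      simp only [Finset.mem_coe, Finset.Nat.mem_antidiagonalTuple]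
      have h2 : ∑ k, ((a - Pi.single i 1) + Pi.single i 1 : Fin q → ℕ) k = n + 1 := by
        rw [tsub_add_cancel_of_le hle, ha]
      simp only [Pi.add_apply, Finset.sum_add_distrib, Finset.sum_pi_single', Finset.mem_univ,
        if_true] at h2
      simp at h2
      simpa using h2
    simp [this]
  · intro b hb
    rw [Finset.Nat.mem_antidiagonalTuple] at hb
    have h := multinomial_step q n i b hb
    have h' : (Nat.multinomial univ (b + Pi.single i 1) : ℝ) * ((b i : ℝ) + 1)
        = ((n : ℝ) + 1) * Nat.multinomial univ b := by exact_mod_cast h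
    simp only [Pi.add_apply, Pi.single_eq_same]
    push_cast
    rw [h']
    ring

lemma sum_total (q n : ℕ) (g : (Fin q → ℕ) → ℝ) :
    ∑ a ∈ Finset.Nat.antidiagonalTuple q (n + 1), (Nat.multinomial univ a : ℝ) * g a
    = ∑ b ∈ Finset.Nat.antidiagonalTuple q n,
      (Nat.multinomial univ b : ℝ) * ∑ i, g (b + Pi.single i 1) := by
  have hn : ((n : ℝ) + 1) ≠ 0 := by positivity
  apply mul_left_cancel₀ hn
  have : ∑ i, ∑ a ∈ Finset.Nat.antidiagonalTuple q (n + 1),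
      (Nat.multinomial univ a : ℝ) * (a i : ℝ) * g a
      = ∑ i : Fin q, ((n : ℝ) + 1) * ∑ b ∈ Finset.Nat.antidiagonalTuple q n,
      (Nat.multinomial univ b : ℝ) * g (b + Pi.single i 1) :=
    Finset.sum_congr rfl fun i _ => sum_step q n i g
  simp only [Finset.mul_sum] at this ⊢
  rw [Finset.sum_comm, Finset.sum_comm (t := Finset.Nat.antidiagonalTuple q n)] at this
  rw [← this]
  apply Finset.sum_congr rfl
  intro a ha
  rw [Finset.Nat.mem_antidiagonalTuple] at ha
  have ha' : ∑ i, (a i : ℝ) = (n : ℝ) + 1 := by exact_mod_cast ha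
  rw [← Finset.sum_mul, ← Finset.mul_sum, ha']
  ring

lemma sum_two (q n : ℕ) (i : Fin q) (g : (Fin q → ℕ) → ℝ) :
    ∑ a ∈ Finset.Nat.antidiagonalTuple q (n + 2),
      (Nat.multinomial univ a : ℝ) * g a * ((a i).choose 2 : ℝ)
    = ((n + 2).choose 2 : ℝ) * ∑ b ∈ Finset.Nat.antidiagonalTuple q n,
      (Nat.multinomial univ b : ℝ) * g (b + Pi.single i 1 + Pi.single i 1) := by
  have h1 := sum_step q (n + 1) i (fun a => g a * (((a i : ℝ) - 1) / 2))
  have h2 := sum_step q n i (fun b => g (b + Pi.single i 1) * (1 / 2))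
  have e : ∑ a ∈ Finset.Nat.antidiagonalTuple q (n + 2),
      (Nat.multinomial univ a : ℝ) * g a * ((a i).choose 2 : ℝ) =
      ∑ a ∈ Finset.Nat.antidiagonalTuple q (n + 1 + 1),
      (Nat.multinomial univ a : ℝ) * (a i : ℝ) * (g a * (((a i : ℝ) - 1) / 2)) := by
    apply Finset.sum_congr rfl
    intro a _
    rw [Nat.cast_choose_two]
    ring
  rw [e, h1]
  have e2 : ∑ b ∈ Finset.Nat.antidiagonalTuple q (n + 1), (Nat.multinomial univ b : ℝ) *
      (g (b + Pi.single i 1) * ((((b + Pi.single i 1 : Fin q → ℕ) i : ℕ) - 1 : ℝ) / 2))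
      = ∑ b ∈ Finset.Nat.antidiagonalTuple q (n + 1), (Nat.multinomial univ b : ℝ) * (b i : ℝ) *
        (g (b + Pi.single i 1) * (1 / 2)) := by
    apply Finset.sum_congr rfl
    intro b _
    simp only [Pi.add_apply, Pi.single_eq_same]
    push_cast
    ring
  rw [e2, h2, Nat.cast_choose_two]
  simp only [← mul_assoc, ← Finset.sum_mul]
  push_cast
  ring

lemma exists_strict (q ℓ n : ℕ) (hq : 3 ≤ q) (hl1 : 1 ≤ ℓ) (hlq : ℓ < q) (hn : ℓ < n + 2) :
    ∃ c : Fin q → ℕ, ∑ k, c k = n ∧ ∃ i j : Fin q,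
      2 * maxl q ℓ (c + Pi.single i 1 + Pi.single j 1) <
        maxl q ℓ (c + Pi.single i 1 + Pi.single i 1) +
        maxl q ℓ (c + Pi.single j 1 + Pi.single j 1) := by
  rcases Nat.eq_or_lt_of_le hl1 with h1 | h1
  · subst h1
    let x : Fin q := ⟨0, by omega⟩
    let y : Fin q := ⟨1, by omega⟩
    let z : Fin q := ⟨2, by omega⟩
    have hxy : x ≠ y := by simp [x, y]
    have hxz : x ≠ z := by simp [x, z]
    have hyz : y ≠ z := by simp [y, z]
    refine ⟨Pi.single x (n / 2) + Pi.single y (n / 2) + Pi.single z (n % 2), ?_, x, y, ?_⟩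
    · simp [Finset.sum_add_distrib]
      omega
    · set c : Fin q → ℕ := Pi.single x (n / 2) + Pi.single y (n / 2) + Pi.single z (n % 2) with hc
      have cx : c x = n / 2 := by simp [hc, hxy, hxz]
      have cy : c y = n / 2 := by simp [hc, hxy.symm, hyz]
      have u1 : maxl q 1 (c + Pi.single x 1 + Pi.single y 1) ≤ n / 2 + 1 := by
        rw [maxl_le_iff]
        intro A hA
        obtain ⟨k, rfl⟩ := Finset.card_eq_one.1 hA
        rw [Finset.sum_singleton]
        by_cases kx : k = x
        · rw [kx]; simp [cx, hxy]
        by_cases ky : k = y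
        · rw [ky]; simp [cy, hxy.symm]
        by_cases kz : k = z
        · rw [kz]; simp [hc, hxy.symm, hxz.symm, hyz.symm]; omega
        · simp [hc, kx, ky, kz]
      have l1 := le_maxl q 1 (c + Pi.single x 1 + Pi.single x 1) {x} (by simp)
      have l2 := le_maxl q 1 (c + Pi.single y 1 + Pi.single y 1) {y} (by simp)
      simp [cx] at l1
      simp [cy] at l2
      omega
  · obtain ⟨B, -, hB⟩ := Finset.exists_subset_card_eq (s := (univ : Finset (Fin q))) (n := ℓ - 1)
      (by simp; omega)
    obtain ⟨i, hi⟩ : ∃ i, i ∉ B := by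
      by_contra! h
      have := Finset.card_le_card (fun k _ => h k : (univ : Finset (Fin q)) ⊆ B)
      simp at this; omega
    have hiB : (insert i B).card = ℓ := by rw [Finset.card_insert_of_notMem hi]; omega
    obtain ⟨j, hj⟩ : ∃ j, j ∉ insert i B := by
      by_contra! h
      have := Finset.card_le_card (fun k _ => h k : (univ : Finset (Fin q)) ⊆ insert i B)
      simp only [Finset.card_univ, Fintype.card_fin] at this; omega
    have hjB' : j ∉ B := fun h => hj (Finset.mem_insert_of_mem h)
    have hij : j ≠ i := fun h => hj (by simp [h])
    have hjB : (insert j B).card = ℓ := by rw [Finset.card_insert_of_notMem hjB']; omega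
    have hC : (insert j (insert i B)).card = ℓ + 1 := by
      rw [Finset.card_insert_of_notMem hj]; omega
    obtain ⟨z, hz⟩ : B.Nonempty := Finset.card_pos.1 (by omega)
    let c : Fin q → ℕ := fun k => (if k = z then n - (ℓ - 1) else 0) + (if k ∈ B then 1 else 0)
    have csum : ∑ k, c k = n := by
      simp [c, Finset.sum_add_distrib, hB]; omega
    have cB : ∀ k ∈ B, 1 ≤ c k := by intro k hk; simp [c, hk]
    have cN : ∀ k, k ∉ B → c k = 0 := by
      intro k hk
      have : k ≠ z := by rintro rfl; exact hk hz
      simp [c, hk, this]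
    have tot : ∀ u v : Fin q, ∑ k, (c + Pi.single u 1 + Pi.single v 1 : Fin q → ℕ) k = n + 2 := by
      intro u v
      simp [Finset.sum_add_distrib, csum]
    have low : ∀ u : Fin q, (insert u B).card = ℓ →
        n + 2 ≤ maxl q ℓ (c + Pi.single u 1 + Pi.single u 1) := by
      intro u hu
      rw [← tot u u]
      refine le_trans (le_of_eq ?_) (le_maxl q ℓ _ (insert u B) hu)
      symm
      apply Finset.sum_subset (Finset.subset_univ _)
      intro k _ hk
      rw [Finset.mem_insert, not_or] at hk
      simp [cN k hk.2, hk.1]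
    have up : maxl q ℓ (c + Pi.single i 1 + Pi.single j 1) ≤ n + 1 := by
      rw [maxl_le_iff]
      intro A hA
      obtain ⟨k, hk, hkA⟩ := Finset.exists_mem_notMem_of_card_lt_card
        (s := A) (t := insert j (insert i B)) (by omega)
      have hpos : 1 ≤ (c + Pi.single i 1 + Pi.single j 1 : Fin q → ℕ) k := by
        simp only [Pi.add_apply]
        rcases Finset.mem_insert.1 hk with rfl | hk
        · simp
        rcases Finset.mem_insert.1 hk with rfl | hk
        · simp; omega
        · have := cB k hk; omega
      have hle := Finset.sum_le_sum_of_subset (f := (c + Pi.single i 1 + Pi.single j 1))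
        (Finset.subset_univ (insert k A))
      rw [Finset.sum_insert hkA, tot i j] at hle
      omega
    have := low i hiB
    have := low j hjB
    exact ⟨c, csum, i, j, by omega⟩

theorem constant_c_q_ell_L_positive (q ℓ L : ℕ) (hq : 3 ≤ q) (hl1 : 1 ≤ ℓ) (hlq : ℓ < q)
    (hLl : ℓ < L) (hL : 2 ≤ L) :
    0 < (1 / (q : ℝ) ^ L) * ∑ a ∈ Finset.Nat.antidiagonalTuple q L,
        ((maxl q ℓ a : ℝ) / (L : ℝ)) * (Nat.multinomial Finset.univ a : ℝ) *
          ((∑ i, ((a i).choose 2 : ℝ)) - (1 / (q : ℝ)) * (L.choose 2 : ℝ)) := by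
  obtain ⟨n, rfl⟩ : ∃ n, L = n + 2 := ⟨L - 2, by omega⟩
  have hq0 : (0 : ℝ) < q := by exact_mod_cast (by omega : 0 < q)
  apply mul_pos (by positivity)
  let f : (Fin q → ℕ) → ℝ := fun a => (maxl q ℓ a : ℝ)
  let S : (Fin q → ℕ) → ℝ := fun b => ∑ i, ∑ j,
    (f (b + Pi.single i 1 + Pi.single i 1) + f (b + Pi.single j 1 + Pi.single j 1)
      - 2 * f (b + Pi.single i 1 + Pi.single j 1))
  have hterm : ∀ (b : Fin q → ℕ) (i j : Fin q), 0 ≤ f (b + Pi.single i 1 + Pi.single i 1)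
      + f (b + Pi.single j 1 + Pi.single j 1) - 2 * f (b + Pi.single i 1 + Pi.single j 1) := by
    intro b i j
    have h := maxl_convex q ℓ b (Pi.single i 1) (Pi.single j 1)
    have h' : 2 * f (b + Pi.single i 1 + Pi.single j 1) ≤ f (b + Pi.single i 1 + Pi.single i 1)
      + f (b + Pi.single j 1 + Pi.single j 1) := by
      simp only [f]; exact_mod_cast h
    linarith
  have hS : ∀ b, 0 ≤ S b := fun b =>
    Finset.sum_nonneg fun i _ => Finset.sum_nonneg fun j _ => hterm b i j
  have key : ∑ a ∈ Finset.Nat.antidiagonalTuple q (n + 2),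
        ((maxl q ℓ a : ℝ) / ((n + 2 : ℕ) : ℝ)) * (Nat.multinomial Finset.univ a : ℝ) *
          ((∑ i, ((a i).choose 2 : ℝ)) - (1 / (q : ℝ)) * ((n + 2).choose 2 : ℝ))
      = ((n + 2).choose 2 : ℝ) / ((n + 2 : ℕ) : ℝ) / (2 * q) *
        ∑ b ∈ Finset.Nat.antidiagonalTuple q n, (Nat.multinomial Finset.univ b : ℝ) * S b := by
    have e1 : ∑ a ∈ Finset.Nat.antidiagonalTuple q (n + 2),
        ((maxl q ℓ a : ℝ) / ((n + 2 : ℕ) : ℝ)) * (Nat.multinomial Finset.univ a : ℝ) *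
          ((∑ i, ((a i).choose 2 : ℝ)) - (1 / (q : ℝ)) * ((n + 2).choose 2 : ℝ))
        = 1 / ((n + 2 : ℕ) : ℝ) * (∑ i, ∑ a ∈ Finset.Nat.antidiagonalTuple q (n + 2),
          (Nat.multinomial univ a : ℝ) * f a * ((a i).choose 2 : ℝ)
          - (1 / (q : ℝ)) * ((n + 2).choose 2 : ℝ) *
            ∑ a ∈ Finset.Nat.antidiagonalTuple q (n + 1 + 1),
              (Nat.multinomial univ a : ℝ) * f a) := by
      rw [Finset.sum_comm, Finset.mul_sum (Finset.Nat.antidiagonalTuple q (n + 1 + 1)),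
        ← Finset.sum_sub_distrib, Finset.mul_sum]
      apply Finset.sum_congr rfl
      intro a _
      rw [← Finset.mul_sum]
      simp only [f]
      ring
    rw [e1, sum_total, sum_total]
    simp only [sum_two]
    rw [← Finset.mul_sum, Finset.sum_comm]
    have e2 : ∀ b : Fin q → ℕ, S b = 2 * q * ∑ i, f (b + Pi.single i 1 + Pi.single i 1)
        - 2 * ∑ i, ∑ j, f (b + Pi.single i 1 + Pi.single j 1) := by
      intro b
      simp only [S, Finset.sum_sub_distrib, Finset.sum_add_distrib, ← Finset.mul_sum,
        Finset.sum_const, Finset.card_univ, Fintype.card_fin, nsmul_eq_mul]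
      ring
    simp only [e2, mul_sub, Finset.sum_sub_distrib, ← Finset.mul_sum, mul_left_comm _ (2 : ℝ),
      mul_left_comm _ (2 * (q : ℝ))]
    field_simp
  rw [key]
  have hch : 0 < ((n + 2).choose 2 : ℝ) := by
    exact_mod_cast Nat.choose_pos (by omega)
  apply mul_pos (by positivity)
  obtain ⟨c, hc, i, j, hstrict⟩ := exists_strict q ℓ n hq hl1 hlq hLl
  apply Finset.sum_pos'
  · intro b _
    exact mul_nonneg (Nat.cast_nonneg _) (hS b)
  · refine ⟨c, Finset.Nat.mem_antidiagonalTuple.2 hc, ?_⟩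
    apply mul_pos
    · exact_mod_cast Nat.multinomial_pos _ _
    · have h' : 2 * f (c + Pi.single i 1 + Pi.single j 1) < f (c + Pi.single i 1 + Pi.single i 1)
        + f (c + Pi.single j 1 + Pi.single j 1) := by
        simp only [f]; exact_mod_cast hstrict
      apply Finset.sum_pos' (fun i _ => Finset.sum_nonneg fun j _ => hterm c i j)
      refine ⟨i, Finset.mem_univ _, ?_⟩
      apply Finset.sum_pos' (fun j _ => hterm c i j)
      exact ⟨j, Finset.mem_univ _, by linarith⟩
end

section
/- Let q ≥ 3 and L ≥ 2 be integers and let P be a probability distribution on [q] with P(x) > 0 for all x ∈ [q]. Then for every probability distribution ω on [L], f(P,ω) ≤ f(P,U_L), with equality if and only if ω = U_L. -/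
open Finset

/-- A probability distribution on a finite type. -/
def IsDist {α : Type*} [Fintype α] (P : α → ℝ) : Prop :=
  (∀ a, 0 ≤ P a) ∧ ∑ a, P a = 1

/-- `max_ω(x₁,…,x_L) = max_{x∈[q]} ∑_{i : xᵢ = x} ω(i)`. -/
noncomputable def maxOmega {q L : ℕ} (ω : Fin L → ℝ) (x : Fin L → Fin q) : ℝ :=
  ⨆ a : Fin q, ∑ i ∈ Finset.univ.filter (fun i => x i = a), ω i

/-- `f(P,ω) = 1 − ∑_{x∈[q]^L} (∏ᵢ P(xᵢ)) · max_ω(x)`. -/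
noncomputable def fF {q L : ℕ} (P : Fin q → ℝ) (ω : Fin L → ℝ) : ℝ :=
  1 - ∑ x : Fin L → Fin q, (∏ i, P (x i)) * maxOmega ω x

lemma le_maxOmega {q L : ℕ} (ω : Fin L → ℝ) (x : Fin L → Fin q) (a : Fin q) :
    ∑ i ∈ Finset.univ.filter (fun i => x i = a), ω i ≤ maxOmega ω x :=
  le_ciSup (f := fun a : Fin q => ∑ i ∈ Finset.univ.filter (fun i => x i = a), ω i)
    (Set.finite_range _).bddAbove a

lemma maxOmega_perm {q L : ℕ} (ω : Fin L → ℝ) (x : Fin L → Fin q) (σ : Equiv.Perm (Fin L)) :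
    maxOmega (fun i => ω (σ i)) (fun i => x (σ i)) = maxOmega ω x := by
  unfold maxOmega
  congr 1
  funext a
  simp only [Finset.sum_filter]
  exact Equiv.sum_comp σ (fun i => if x i = a then ω i else 0)

lemma gsum_perm {q L : ℕ} (P : Fin q → ℝ) (ω : Fin L → ℝ) (σ : Equiv.Perm (Fin L)) :
    ∑ x : Fin L → Fin q, (∏ i, P (x i)) * maxOmega (fun i => ω (σ i)) x
      = ∑ x : Fin L → Fin q, (∏ i, P (x i)) * maxOmega ω x := by
  symm
  refine Fintype.sum_equiv (Equiv.arrowCongr σ.symm (Equiv.refl (Fin q))) _ _ ?_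
  intro x
  have h : (Equiv.arrowCongr σ.symm (Equiv.refl (Fin q))) x = fun i => x (σ i) := by
    funext i; simp [Equiv.arrowCongr]
  rw [h, maxOmega_perm, Equiv.prod_comp σ (fun i => P (x i))]

lemma sum_perm_apply {L : ℕ} (ω : Fin L → ℝ) (hs : ∑ i, ω i = 1) (i : Fin L) :
    ∑ σ : Equiv.Perm (Fin L), ω (σ i) = (L.factorial : ℝ) * (1 / (L : ℝ)) := by
  have hc : ∀ j, ∑ σ : Equiv.Perm (Fin L), ω (σ j) = ∑ σ : Equiv.Perm (Fin L), ω (σ i) := by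
    intro j
    refine Fintype.sum_equiv (Equiv.mulRight (Equiv.swap i j)) _ _ ?_
    intro σ
    simp
  have h1 : ∑ j, ∑ σ : Equiv.Perm (Fin L), ω (σ j) = (L.factorial : ℝ) := by
    rw [Finset.sum_comm]
    have : ∀ σ : Equiv.Perm (Fin L), ∑ j, ω (σ j) = 1 := fun σ => by
      rw [Equiv.sum_comp σ ω, hs]
    simp [this, Fintype.card_perm]
  simp only [hc, Finset.sum_const, Finset.card_univ, Fintype.card_fin, nsmul_eq_mul] at h1
  have hL : (L : ℝ) ≠ 0 := by
    have := i.pos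
    positivity
  field_simp
  linarith

lemma sum_class {q L : ℕ} (ω : Fin L → ℝ) (hs : ∑ i, ω i = 1) (x : Fin L → Fin q) (a : Fin q) :
    ∑ σ : Equiv.Perm (Fin L), ∑ i ∈ Finset.univ.filter (fun i => x i = a), ω (σ i)
      = (L.factorial : ℝ) * ∑ i ∈ Finset.univ.filter (fun i => x i = a), (1 / (L : ℝ)) := by
  rw [Finset.sum_comm, Finset.mul_sum]
  exact Finset.sum_congr rfl fun i _ => sum_perm_apply ω hs i

lemma avg_ge {q L : ℕ} (hq : 3 ≤ q) (ω : Fin L → ℝ) (hs : ∑ i, ω i = 1) (x : Fin L → Fin q) :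
    (L.factorial : ℝ) * maxOmega (fun _ : Fin L => 1 / (L : ℝ)) x
      ≤ ∑ σ : Equiv.Perm (Fin L), maxOmega (fun i => ω (σ i)) x := by
  haveI : Nonempty (Fin q) := ⟨⟨0, by omega⟩⟩
  obtain ⟨a, ha⟩ := exists_eq_ciSup_of_finite
    (f := fun a : Fin q => ∑ i ∈ Finset.univ.filter (fun i => x i = a), (1 / (L : ℝ)))
  have ha' : maxOmega (fun _ : Fin L => 1 / (L : ℝ)) x
      = ∑ i ∈ Finset.univ.filter (fun i => x i = a), (1 / (L : ℝ)) := ha.symm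
  rw [ha', ← sum_class ω hs x a]
  exact Finset.sum_le_sum fun σ _ => le_maxOmega _ x a

/-- If equality holds for a word in which `a` attains the uniform maximum, then `a` attains the
maximum for every permutation. -/
lemma avg_eq {q L : ℕ} (ω : Fin L → ℝ) (hs : ∑ i, ω i = 1) (x : Fin L → Fin q)
    (h : (L.factorial : ℝ) * maxOmega (fun _ : Fin L => 1 / (L : ℝ)) x
      = ∑ σ : Equiv.Perm (Fin L), maxOmega (fun i => ω (σ i)) x) (a : Fin q)
    (ha : maxOmega (fun _ : Fin L => 1 / (L : ℝ)) x
      = ∑ i ∈ Finset.univ.filter (fun i => x i = a), (1 / (L : ℝ))) (σ : Equiv.Perm (Fin L)) :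
    ∑ i ∈ Finset.univ.filter (fun i => x i = a), ω (σ i) = maxOmega (fun i => ω (σ i)) x := by
  rw [ha, ← sum_class ω hs x a] at h
  exact (Finset.sum_eq_sum_iff_of_le
    (fun σ _ => le_maxOmega (fun i => ω (σ i)) x a)).1 h σ (Finset.mem_univ _)

/-- the balanced word -/
def balWord (q L : ℕ) (hq : 3 ≤ q) : Fin L → Fin q := fun i =>
  if (i : ℕ) < L / 2 then ⟨0, by omega⟩ else if (i : ℕ) < 2 * (L / 2) then ⟨1, by omega⟩
    else ⟨2, by omega⟩

lemma card_fin_between (L b c : ℕ) (hc : c ≤ L) :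
    (Finset.univ.filter (fun i : Fin L => b ≤ (i : ℕ) ∧ (i : ℕ) < c)).card = c - b := by
  rw [← Nat.card_Ico, ← Finset.card_map Fin.valEmbedding]
  congr 1
  ext n
  simp only [Finset.mem_map, Finset.mem_filter, Finset.mem_univ, true_and, Fin.valEmbedding_apply,
    Finset.mem_Ico]
  constructor
  · rintro ⟨i, hi, rfl⟩; exact hi
  · intro h; exact ⟨⟨n, by omega⟩, h, rfl⟩

lemma balWord_filter (q L : ℕ) (hq : 3 ≤ q) (a : Fin q) :
    (Finset.univ.filter (fun i : Fin L => balWord q L hq i = a)).card =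
      if (a : ℕ) = 0 then L / 2 else if (a : ℕ) = 1 then L / 2
        else if (a : ℕ) = 2 then L - 2 * (L / 2) else 0 := by
  have key : ∀ b c : ℕ, c ≤ L → (∀ i : Fin L, balWord q L hq i = a ↔ b ≤ (i : ℕ) ∧ (i : ℕ) < c) →
      (Finset.univ.filter (fun i : Fin L => balWord q L hq i = a)).card = c - b := by
    intro b c hc h
    rw [← card_fin_between L b c hc]
    congr 1
    ext i
    simp [h]
  have hval : ∀ i : Fin L, balWord q L hq i = a ↔
      (if (i : ℕ) < L / 2 then 0 else if (i : ℕ) < 2 * (L / 2) then 1 else 2) = (a : ℕ) := by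
    intro i
    rw [Fin.ext_iff]
    unfold balWord
    split_ifs <;> simp
  split_ifs with h0 h1 h2
  · rw [key 0 (L / 2) (by omega)]
    · omega
    · intro i; rw [hval]; split_ifs <;> omega
  · rw [key (L / 2) (2 * (L / 2)) (by omega)]
    · omega
    · intro i; rw [hval]; split_ifs <;> omega
  · rw [key (2 * (L / 2)) L (by omega)]
    intro i; have := i.2; rw [hval]; split_ifs <;> omega
  · rw [key 0 0 (by omega)]
    intro i; rw [hval]; split_ifs <;> omega

lemma balWord_max (q L : ℕ) (hq : 3 ≤ q) (hL : 2 ≤ L) (a : Fin q) (ha : (a : ℕ) < 2) :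
    maxOmega (fun _ : Fin L => 1 / (L : ℝ)) (balWord q L hq)
      = ∑ i ∈ Finset.univ.filter (fun i => balWord q L hq i = a), (1 / (L : ℝ)) := by
  haveI : Nonempty (Fin q) := ⟨a⟩
  apply le_antisymm
  · apply ciSup_le
    intro b
    rw [Finset.sum_const, Finset.sum_const, nsmul_eq_mul, nsmul_eq_mul]
    apply mul_le_mul_of_nonneg_right _ (by positivity)
    rw [balWord_filter, balWord_filter]
    norm_cast
    split_ifs <;> omega
  · exact le_maxOmega (fun _ : Fin L => 1 / (L : ℝ)) _ a

lemma uniform_of_balanced (q L : ℕ) (hq : 3 ≤ q) (hL : 2 ≤ L) (ω : Fin L → ℝ)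
    (hs : ∑ i, ω i = 1)
    (h : (L.factorial : ℝ) * maxOmega (fun _ : Fin L => 1 / (L : ℝ)) (balWord q L hq)
      = ∑ σ : Equiv.Perm (Fin L), maxOmega (fun i => ω (σ i)) (balWord q L hq)) :
    ω = fun _ : Fin L => 1 / (L : ℝ) := by
  set x := balWord q L hq with hx
  set a0 : Fin q := ⟨0, by omega⟩ with ha0
  set a1 : Fin q := ⟨1, by omega⟩ with ha1
  have h01 : a0 ≠ a1 := by simp [ha0, ha1]
  have hD : ∀ σ : Equiv.Perm (Fin L),
      ∑ i, ((if x i = a0 then (1 : ℝ) else 0) - (if x i = a1 then 1 else 0)) * ω (σ i) = 0 := by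
    intro σ
    have e0 := avg_eq ω hs x h a0 (balWord_max q L hq hL a0 (by simp [ha0])) σ
    have e1 := avg_eq ω hs x h a1 (balWord_max q L hq hL a1 (by simp [ha1])) σ
    rw [Finset.sum_filter] at e0 e1
    simp only [sub_mul, ite_mul, one_mul, zero_mul, Finset.sum_sub_distrib]
    linarith
  set p0 : Fin L := ⟨0, by omega⟩ with hp0
  set pk : Fin L := ⟨L / 2, by omega⟩ with hpk
  have hne : p0 ≠ pk := by
    simp only [hp0, hpk, ne_eq, Fin.mk.injEq]; omega
  have hx0 : x p0 = a0 := by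
    have : 0 < L / 2 := by omega
    simp [hx, balWord, hp0, ha0, this]
  have hxk : x pk = a1 := by
    have : L / 2 < 2 * (L / 2) := by omega
    simp [hx, balWord, hpk, ha1, this]
  have hsw : ∀ σ : Equiv.Perm (Fin L), ω (σ p0) = ω (σ pk) := by
    intro σ
    have d1 := hD σ
    have d2 := hD (σ * Equiv.swap p0 pk)
    have d3 : ∑ i, ((if x i = a0 then (1 : ℝ) else 0) - (if x i = a1 then 1 else 0)) *
        (ω (σ i) - ω ((σ * Equiv.swap p0 pk) i)) = 0 := by
      simp only [mul_sub, Finset.sum_sub_distrib]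
      simp only [d1, d2, sub_zero]
    rw [Fintype.sum_eq_add p0 pk hne] at d3
    · simp [hx0, hxk, h01, h01.symm] at d3
      linarith
    · rintro i ⟨hi0, hik⟩
      simp [Equiv.swap_apply_of_ne_of_ne hi0 hik]
  have hconst : ∀ j, ω j = ω p0 := by
    intro j
    by_cases hj : j = p0
    · rw [hj]
    · have := hsw (Equiv.swap pk j)
      rw [Equiv.swap_apply_of_ne_of_ne hne (Ne.symm hj), Equiv.swap_apply_left] at this
      exact this.symm
  have hL0 : (L : ℝ) ≠ 0 := by
    have : 0 < L := by omega
    positivity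
  simp only [hconst, Finset.sum_const, Finset.card_univ, Fintype.card_fin, nsmul_eq_mul] at hs
  funext j
  rw [hconst j]
  field_simp
  linarith

theorem fF_uniquely_maximized_at_uniform (q L : ℕ) (hq : 3 ≤ q) (hL : 2 ≤ L)
    (P : Fin q → ℝ) (hP : IsDist P) (hPpos : ∀ x : Fin q, 0 < P x)
    (ω : Fin L → ℝ) (hω : IsDist ω) :
    fF P ω ≤ fF P (fun _ : Fin L => 1 / (L : ℝ)) ∧
      (fF P ω = fF P (fun _ : Fin L => 1 / (L : ℝ)) ↔ ω = fun _ : Fin L => 1 / (L : ℝ)) := by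
  have hs := hω.2
  have hw : ∀ x : Fin L → Fin q, 0 < ∏ i, P (x i) := fun x =>
    Finset.prod_pos fun i _ => hPpos (x i)
  have hf : (0 : ℝ) < (L.factorial : ℝ) := by exact_mod_cast L.factorial_pos
  have hG : (L.factorial : ℝ) * ∑ x : Fin L → Fin q, (∏ i, P (x i)) * maxOmega ω x
      = ∑ x : Fin L → Fin q, (∏ i, P (x i)) *
        ∑ σ : Equiv.Perm (Fin L), maxOmega (fun i => ω (σ i)) x := by
    simp only [Finset.mul_sum (s := (Finset.univ : Finset (Equiv.Perm (Fin L))))]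
    rw [Finset.sum_comm]
    simp [gsum_perm, Fintype.card_perm]
  have hU : (L.factorial : ℝ) * ∑ x : Fin L → Fin q,
        (∏ i, P (x i)) * maxOmega (fun _ : Fin L => 1 / (L : ℝ)) x
      = ∑ x : Fin L → Fin q, (∏ i, P (x i)) *
        ((L.factorial : ℝ) * maxOmega (fun _ : Fin L => 1 / (L : ℝ)) x) := by
    rw [Finset.mul_sum]
    exact Finset.sum_congr rfl fun x _ => by ring
  have hle : ∀ x ∈ (Finset.univ : Finset (Fin L → Fin q)), (∏ i, P (x i)) *
        ((L.factorial : ℝ) * maxOmega (fun _ : Fin L => 1 / (L : ℝ)) x) ≤ (∏ i, P (x i)) *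
        ∑ σ : Equiv.Perm (Fin L), maxOmega (fun i => ω (σ i)) x := fun x _ =>
    mul_le_mul_of_nonneg_left (avg_ge hq ω hs x) (hw x).le
  refine ⟨?_, ?_, ?_⟩
  · unfold fF
    have := Finset.sum_le_sum hle
    rw [← hG, ← hU] at this
    have := le_of_mul_le_mul_left this hf
    linarith
  · intro h
    unfold fF at h
    have h' : ∑ x : Fin L → Fin q,
        (∏ i, P (x i)) * maxOmega (fun _ : Fin L => 1 / (L : ℝ)) x =
        ∑ x : Fin L → Fin q, (∏ i, P (x i)) * maxOmega ω x := by linarith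
    have h2 := congrArg (fun t => (L.factorial : ℝ) * t) h'
    replace h2 := (hU.symm.trans h2).trans hG
    have h3 := (Finset.sum_eq_sum_iff_of_le hle).1 h2 (balWord q L hq) (Finset.mem_univ _)
    exact uniform_of_balanced q L hq hL ω hs (mul_left_cancel₀ (hw _).ne' h3)
  · intro h
    rw [h]
end

section
/- Let q ≥ 2, L ≥ 2, let C ⊆ [q]^n be a nonempty code, and let p ∈ [1/q, 1] be such that radh(C) ≤ 1 − p. Then for every probability distribution ω on [L], the average over all L-tuples (c_1,...,c_L) ∈ C^L (sampled uniformly with replacement) of rad_ω(φ(c_1),...,φ(c_L)) is at most f(P_{q,p}, U_L). -/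
open Finset

/-- The embedding `φ : [q] → ∂Δ` sending `x` to the standard basis vector `e_x`. -/
noncomputable def phi (q : ℕ) (x : Fin q) : Fin q → ℝ := fun k => if k = x then 1 else 0

/-- `d(x,y) = (1/2) ∑_j ‖x(j) − y(j)‖₁` for blocks in `ℝ^q`. -/
noncomputable def dvec {q n : ℕ} (x y : Fin n → Fin q → ℝ) : ℝ :=
  (1 / 2) * ∑ j, ∑ k, |x j k - y j k|

/-- The weighted average radius `rad_ω(x₁,…,x_L) = (1/n) inf_{y∈Δⁿ} ∑_i ω(i) d(xᵢ,y)`. -/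
noncomputable def radOmega {q n L : ℕ} (ω : Fin L → ℝ) (xs : Fin L → Fin n → Fin q → ℝ) : ℝ :=
  (1 / (n : ℝ)) *
    sInf {r : ℝ | ∃ y : Fin n → Fin q → ℝ, (∀ j, IsDist (y j)) ∧ r = ∑ i, ω i * dvec (xs i) y}

/-- The Chebyshev radius of a code: `radh(C) = (1/n) min_{y∈[q]^n} max_{c∈C} d_H(c,y)`. -/
noncomputable def radhCode {q n : ℕ} (C : Finset (Fin n → Fin q)) : ℝ :=
  (1 / (n : ℝ)) * ⨅ y : Fin n → Fin q, sSup {d : ℝ | ∃ c ∈ C, d = (hammingDist c y : ℝ)}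

/-- The distribution `P_{q,p}`: mass `p` on the last symbol, `(1−p)/(q−1)` on the others. -/
noncomputable def Pqp (q : ℕ) (p : ℝ) : Fin q → ℝ :=
  fun x => if (x : ℕ) = q - 1 then p else (1 - p) / ((q : ℝ) - 1)


namespace AvgRad

/-- Count vector of a tuple. -/
def cnt {q l : ℕ} (x : Fin l → Fin q) : Fin q → ℕ := fun a => #{i | x i = a}

/-- Expectation of a function of the count vector of `l` i.i.d. samples. -/
noncomputable def EE {q : ℕ} (l : ℕ) (P : Fin q → ℝ) (φ : (Fin q → ℕ) → ℝ) : ℝ :=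
  ∑ x : Fin l → Fin q, (∏ i, P (x i)) * φ (cnt x)

/-- Directional difference operator. -/
noncomputable def DD {q : ℕ} (v : Fin q → ℝ) (φ : (Fin q → ℕ) → ℝ) : (Fin q → ℕ) → ℝ :=
  fun N => ∑ a, v a * φ (N + Pi.single a 1)

/-- Maximal count. -/
def mx {q : ℕ} (N : Fin q → ℕ) : ℕ := univ.sup N

/-- Set of symbols with maximal count. -/
def TT {q : ℕ} (N : Fin q → ℕ) : Finset (Fin q) := {a | N a = mx N}

/-- maximal count as a real number -/
noncomputable def MM {q : ℕ} (N : Fin q → ℕ) : ℝ := (mx N : ℝ)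

lemma cnt_cons {q l : ℕ} (a : Fin q) (x : Fin l → Fin q) :
    cnt (Fin.cons a x : Fin (l+1) → Fin q) = cnt x + Pi.single a 1 := by
  funext b
  simp only [cnt, Finset.card_filter, Fin.sum_univ_succ, Fin.cons_zero, Fin.cons_succ,
    Pi.add_apply, Pi.single_apply]
  rw [add_comm]
  congr 1
  simp [eq_comm]

lemma EE_zero {q : ℕ} (P : Fin q → ℝ) (φ : (Fin q → ℕ) → ℝ) : EE 0 P φ = φ 0 := by
  have : cnt (default : Fin 0 → Fin q) = 0 := by funext a; simp [cnt]
  simp [EE, this]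

lemma EE_succ {q l : ℕ} (P : Fin q → ℝ) (φ : (Fin q → ℕ) → ℝ) :
    EE (l+1) P φ = ∑ a, P a * EE l P (fun N => φ (N + Pi.single a 1)) := by
  unfold EE
  rw [← (Fin.consEquiv (fun _ : Fin (l+1) => Fin q)).sum_comp, Fintype.sum_prod_type]
  refine Finset.sum_congr rfl fun a _ => ?_
  rw [Finset.mul_sum]
  refine Finset.sum_congr rfl fun x _ => ?_
  have h : cnt ((Fin.consEquiv fun _ => Fin q) (a, x)) = cnt x + Pi.single a 1 := cnt_cons a x
  rw [h]
  simp only [Fin.consEquiv_apply, Fin.prod_univ_succ, Fin.cons_zero, Fin.cons_succ]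
  ring

lemma EE_DD {q l : ℕ} (P v : Fin q → ℝ) (φ : (Fin q → ℕ) → ℝ) :
    EE l P (DD v φ) = ∑ a, v a * EE l P (fun N => φ (N + Pi.single a 1)) := by
  unfold EE DD
  simp only [Finset.mul_sum]
  rw [Finset.sum_comm]
  refine Finset.sum_congr rfl fun x _ => Finset.sum_congr rfl fun a _ => by ring

lemma hasDerivAt_EE {q : ℕ} (A v : Fin q → ℝ) (t : ℝ) (l : ℕ) : ∀ (φ : (Fin q → ℕ) → ℝ),
    HasDerivAt (fun s : ℝ => EE (l+1) (fun a => A a + s * v a) φ)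
      ((l + 1 : ℝ) * EE l (fun a => A a + t * v a) (DD v φ)) t := by
  have hP : ∀ a, HasDerivAt (fun s : ℝ => A a + s * v a) (v a) t := fun a => by
    simpa using ((hasDerivAt_id t).mul_const (v a)).const_add (A a)
  induction l with
  | zero =>
    intro φ
    simp only [EE_succ, EE_zero, DD]
    have := HasDerivAt.fun_sum (u := univ) (fun a _ => (hP a).mul_const (φ (0 + Pi.single a 1)))
    simpa using this
  | succ l ih =>
    intro φ
    have key := HasDerivAt.fun_sum (u := univ)
      (fun a _ => (hP a).mul (ih (fun N => φ (N + Pi.single a 1))))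
    have e : (fun s : ℝ => EE (l+1+1) (fun a => A a + s * v a) φ) = fun s => ∑ a, (A a + s * v a) *
        EE (l+1) (fun a => A a + s * v a) (fun N => φ (N + Pi.single a 1)) := by
      funext s; rw [EE_succ]
    rw [e]
    refine key.congr_deriv ?_
    rw [Finset.sum_add_distrib, ← EE_DD]
    have : ∑ a, (A a + t * v a) * ((l + 1 : ℝ) * EE l (fun a => A a + t * v a)
        (DD v (fun N => φ (N + Pi.single a 1)))) =
        (l+1 : ℝ) * EE (l+1) (fun a => A a + t * v a) (DD v φ) := by
      rw [EE_succ, Finset.mul_sum]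
      refine Finset.sum_congr rfl fun a _ => ?_
      have : (fun N => DD v φ (N + Pi.single a 1)) = DD v (fun N => φ (N + Pi.single a 1)) := by
        funext N; simp only [DD]
        refine Finset.sum_congr rfl fun b _ => ?_
        rw [add_right_comm]
      rw [this]; ring
    rw [this]; push_cast; ring

lemma le_mx {q : ℕ} (N : Fin q → ℕ) (a : Fin q) : N a ≤ mx N := Finset.le_sup (mem_univ a)

lemma mem_TT {q : ℕ} (N : Fin q → ℕ) (a : Fin q) : a ∈ TT N ↔ N a = mx N := by simp [TT]

lemma exists_mx {q : ℕ} (N : Fin q → ℕ) (a : Fin q) : ∃ b, N b = mx N := by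
  obtain ⟨b, -, hb⟩ := Finset.exists_mem_eq_sup univ ⟨a, mem_univ a⟩ N
  exact ⟨b, hb.symm⟩

lemma mx_add {q : ℕ} (N : Fin q → ℕ) (a : Fin q) :
    mx (N + Pi.single a 1) = mx N + if a ∈ TT N then 1 else 0 := by
  obtain ⟨b, hb⟩ := exists_mx N a
  obtain ⟨c, hc⟩ := exists_mx (N + Pi.single a 1) a
  have h1 := le_mx N c
  have h2 := le_mx N a
  have h3 := le_mx (N + Pi.single a 1) a
  have h4 := le_mx (N + Pi.single a 1) b
  simp only [Pi.add_apply, Pi.single_apply, mem_TT] at *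
  grind

lemma mem_TT_add {q : ℕ} (N : Fin q → ℕ) (a b : Fin q) :
    b ∈ TT (N + Pi.single a 1) ↔
      if a ∈ TT N then b = a else (b ∈ TT N ∨ (b = a ∧ N a + 1 = mx N)) := by
  rw [mem_TT, mx_add]
  have h1 := le_mx N a
  have h2 := le_mx N b
  simp only [Pi.add_apply, Pi.single_apply, mem_TT] at *
  grind

/-- first difference of the maximum -/
lemma DD_MM {q : ℕ} (v : Fin q → ℝ) (hv : ∑ a, v a = 0) (N : Fin q → ℕ) :
    DD v MM N = ∑ a ∈ TT N, v a := by
  simp only [DD, MM, mx_add]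
  push_cast
  simp only [mul_add, Finset.sum_add_distrib, ← Finset.sum_mul, hv]
  simp [Finset.sum_ite_mem]

lemma DD_DD_MM {q : ℕ} (v : Fin q → ℝ) (hv : ∑ a, v a = 0) (N : Fin q → ℕ) :
    ∑ a ∈ TT N, v a ^ 2 - (∑ a ∈ TT N, v a) ^ 2 ≤ DD v (DD v MM) N := by
  have h : ∀ a, (if a ∈ TT N then v a ^ 2 else v a * ∑ b ∈ TT N, v b) ≤
      v a * DD v MM (N + Pi.single a 1) := by
    intro a
    rw [DD_MM v hv]
    by_cases ha : a ∈ TT N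
    · have : TT (N + Pi.single a 1) = {a} := by
        ext b; rw [mem_TT_add]; simp [ha]
      rw [this]; simp [ha, sq]
    · by_cases h1 : N a + 1 = mx N
      · have : TT (N + Pi.single a 1) = insert a (TT N) := by
          ext b; rw [mem_TT_add]; simp [ha, h1, or_comm]
        rw [this, Finset.sum_insert ha]; simp [ha, mul_add, mul_self_nonneg]
      · have : TT (N + Pi.single a 1) = TT N := by
          ext b; rw [mem_TT_add]; simp [ha, h1]
        rw [this]; simp [ha]
  refine le_trans (le_of_eq ?_) (Finset.sum_le_sum fun a _ => h a)
  rw [Finset.sum_ite]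
  have e1 : univ.filter (fun a => a ∈ TT N) = TT N := by ext; simp
  have e2 := Finset.sum_filter_add_sum_filter_not univ (fun a => a ∈ TT N) v
  rw [e1] at e2 ⊢
  rw [← Finset.sum_mul]
  rw [hv] at e2
  have : ∑ a with a ∉ TT N, v a = - ∑ a ∈ TT N, v a := by linarith
  rw [this]; ring

lemma cnt_comp {q l : ℕ} (x : Fin l → Fin q) (σ : Equiv.Perm (Fin q)) :
    cnt (fun i => σ (x i)) = cnt x ∘ σ.symm := by
  funext a; simp [cnt, Equiv.eq_symm_apply]

lemma mx_comp {q : ℕ} (N : Fin q → ℕ) (σ : Equiv.Perm (Fin q)) : mx (N ∘ σ) = mx N := by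
  apply le_antisymm
  · exact Finset.sup_le fun a _ => le_mx N (σ a)
  · refine Finset.sup_le fun a _ => ?_
    have := le_mx (N ∘ σ) (σ.symm a)
    simpa using this

lemma mem_TT_comp {q : ℕ} (N : Fin q → ℕ) (σ : Equiv.Perm (Fin q)) (a : Fin q) :
    a ∈ TT (N ∘ σ) ↔ σ a ∈ TT N := by
  simp [mem_TT, mx_comp]

lemma card_TT_comp {q : ℕ} (N : Fin q → ℕ) (σ : Equiv.Perm (Fin q)) :
    #(TT (N ∘ σ)) = #(TT N) := by
  apply Finset.card_bij (fun a _ => σ a)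
  · intro a ha; exact (mem_TT_comp N σ a).1 ha
  · intro a _ b _ h; exact σ.injective h
  · intro b hb; exact ⟨σ.symm b, (mem_TT_comp N σ _).2 (by simpa using hb), by simp⟩

lemma EE_comp {q l : ℕ} (P : Fin q → ℝ) (σ : Equiv.Perm (Fin q)) (φ : (Fin q → ℕ) → ℝ) :
    EE l P φ = EE l (P ∘ σ) (fun N => φ (N ∘ σ.symm)) := by
  unfold EE
  rw [← (Equiv.arrowCongr (Equiv.refl (Fin l)) σ).sum_comp]
  refine Finset.sum_congr rfl fun x _ => ?_
  have : (Equiv.arrowCongr (Equiv.refl (Fin l)) σ) x = fun i => σ (x i) := by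
    funext i; simp [Equiv.arrowCongr]
  rw [this, cnt_comp]; rfl

lemma prod_cnt {q l : ℕ} (P : Fin q → ℝ) (x : Fin l → Fin q) :
    ∏ i, P (x i) = ∏ a, P a ^ cnt x a := by
  rw [← Finset.prod_fiberwise univ x]
  refine Finset.prod_congr rfl fun a _ => ?_
  rw [Finset.prod_congr rfl (g := fun _ => P a)]
  · simp [cnt]
  · intro i hi; simp at hi; rw [hi]

lemma prod_split {q : ℕ} (g : Fin q → ℝ) (a b : Fin q) (hab : a ≠ b) :
    ∏ c, g c = g a * g b * ∏ c ∈ (univ.erase a).erase b, g c := by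
  rw [← Finset.mul_prod_erase univ g (mem_univ a),
    ← Finset.mul_prod_erase (univ.erase a) g (a := b) (by simp [hab.symm])]
  ring

lemma pow_swap {u v : ℝ} (hv : 0 ≤ v) (huv : v ≤ u) {m n : ℕ} (hmn : n ≤ m) :
    u ^ n * v ^ m ≤ u ^ m * v ^ n := by
  obtain ⟨k, rfl⟩ := Nat.exists_eq_add_of_le hmn
  have := pow_le_pow_left₀ hv huv k
  have h2 : 0 ≤ u ^ n * v ^ n := mul_nonneg (pow_nonneg (hv.trans huv) _) (pow_nonneg hv _)
  calc _ = u ^ n * v ^ n * v ^ k := by ring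
    _ ≤ u ^ n * v ^ n * u ^ k := mul_le_mul_of_nonneg_left this h2
    _ = _ := by ring

lemma swap_le {q l : ℕ} (P : Fin q → ℝ) (hP : ∀ a, 0 ≤ P a) (h : ℕ → ℝ) (hh : ∀ n, 1 ≤ n → 0 ≤ h n)
    (a b : Fin q) (hab : P b ≤ P a) :
    EE l P (fun N => if b ∈ TT N then h #(TT N) else 0) ≤
      EE l P (fun N => if a ∈ TT N then h #(TT N) else 0) := by
  by_cases hne : a = b
  · rw [hne]
  set σ := Equiv.swap a b with hσ
  have e1 := EE_comp (l := l) P σ (fun N => if b ∈ TT N then h #(TT N) else 0)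
  have e2 := EE_comp (l := l) P σ (fun N => if a ∈ TT N then h #(TT N) else 0)
  simp only [mem_TT_comp, card_TT_comp] at e1 e2
  have s1 : σ.symm b = a := by simp [hσ]
  have s2 : σ.symm a = b := by simp [hσ]
  simp only [s1, s2] at e1 e2
  suffices H : EE l P (fun N => if b ∈ TT N then h #(TT N) else 0) +
      EE l (P ∘ σ) (fun N => if a ∈ TT N then h #(TT N) else 0) ≤
      EE l P (fun N => if a ∈ TT N then h #(TT N) else 0) +
      EE l (P ∘ σ) (fun N => if b ∈ TT N then h #(TT N) else 0) by linarith
  unfold EE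
  rw [← Finset.sum_add_distrib, ← Finset.sum_add_distrib]
  refine Finset.sum_le_sum fun x _ => ?_
  rw [prod_cnt P x, prod_cnt (P ∘ σ) x, prod_split _ a b hne, prod_split (fun c => (P ∘ σ) c ^ _) a b hne]
  set N := cnt x
  have hR : ∏ c ∈ (univ.erase a).erase b, (P ∘ σ) c ^ N c =
      ∏ c ∈ (univ.erase a).erase b, P c ^ N c := by
    refine Finset.prod_congr rfl fun c hc => ?_
    simp only [mem_erase] at hc
    simp [hσ, Equiv.swap_apply_of_ne_of_ne hc.2.1 hc.1]
  rw [hR]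
  have hR0 : 0 ≤ ∏ c ∈ (univ.erase a).erase b, P c ^ N c :=
    Finset.prod_nonneg fun c _ => pow_nonneg (hP c) _
  set R := ∏ c ∈ (univ.erase a).erase b, P c ^ N c
  have p1 : (P ∘ σ) a = P b := by simp [hσ]
  have p2 : (P ∘ σ) b = P a := by simp [hσ]
  rw [p1, p2]
  by_cases ha : a ∈ TT N <;> by_cases hb : b ∈ TT N
  · simp only [ha, hb, if_true]; linarith
  · simp only [ha, hb, if_true, if_false]
    have hn : N b ≤ N a := by rw [(mem_TT N a).1 ha]; exact le_mx N b
    have hc : 0 ≤ h #(TT N) := hh _ (Finset.card_pos.2 ⟨a, ha⟩)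
    have := pow_swap (hP b) hab hn
    have := mul_le_mul_of_nonneg_right this (mul_nonneg hR0 hc)
    linarith
  · simp only [ha, hb, if_true, if_false]
    have hn : N a ≤ N b := by rw [(mem_TT N b).1 hb]; exact le_mx N a
    have hc : 0 ≤ h #(TT N) := hh _ (Finset.card_pos.2 ⟨b, hb⟩)
    have := pow_swap (hP b) hab hn
    have := mul_le_mul_of_nonneg_right this (mul_nonneg hR0 hc)
    linarith
  · simp [ha, hb]

lemma EE_sum {q l : ℕ} (P c : Fin q → ℝ) (φ : Fin q → (Fin q → ℕ) → ℝ) :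
    EE l P (fun N => ∑ a, c a * φ a N) = ∑ a, c a * EE l P (φ a) := by
  unfold EE
  simp only [Finset.mul_sum]
  rw [Finset.sum_comm]
  refine Finset.sum_congr rfl fun x _ => Finset.sum_congr rfl fun a _ => by ring

lemma EE_mono {q l : ℕ} (P : Fin q → ℝ) (hP : ∀ a, 0 ≤ P a) (φ ψ : (Fin q → ℕ) → ℝ)
    (h : ∀ N, φ N ≤ ψ N) : EE l P φ ≤ EE l P ψ :=
  Finset.sum_le_sum fun _ _ => mul_le_mul_of_nonneg_left (h _) (Finset.prod_nonneg fun _ _ => hP _)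

lemma EE_sub {q l : ℕ} (P : Fin q → ℝ) (φ ψ : (Fin q → ℕ) → ℝ) :
    EE l P (fun N => φ N - ψ N) = EE l P φ - EE l P ψ := by
  simp [EE, mul_sub, Finset.sum_sub_distrib]

/-- averaging over a set of symbols decreases the expected maximum -/
lemma schur {q l : ℕ} (P : Fin q → ℝ) (hP : ∀ a, 0 ≤ P a) (S : Finset (Fin q)) (hS : S.Nonempty) :
    EE (l+1) (fun a => if a ∈ S then (∑ b ∈ S, P b) / #S else P a) MM ≤ EE (l+1) P MM := by
  have hc : (0:ℝ) < #S := by exact_mod_cast hS.card_pos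
  set m := (∑ b ∈ S, P b) / #S with hm
  have hm0 : 0 ≤ m := div_nonneg (Finset.sum_nonneg fun b _ => hP b) hc.le
  set v : Fin q → ℝ := fun a => if a ∈ S then m - P a else 0 with hv
  have hvS : ∑ a ∈ S, v a = 0 := by
    rw [Finset.sum_congr rfl (g := fun a => m - P a) (fun a ha => by simp [hv, ha])]
    rw [Finset.sum_sub_distrib, Finset.sum_const, nsmul_eq_mul, hm]
    field_simp; ring
  have hv0 : ∑ a, v a = 0 := by
    rw [← hvS]; symm
    exact Finset.sum_subset (Finset.subset_univ _) (fun a _ ha => by simp [hv, ha])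
  have hd := fun t => hasDerivAt_EE P v t l MM
  have hanti : AntitoneOn (fun s : ℝ => EE (l+1) (fun a => P a + s * v a) MM) (Set.Icc 0 1) := by
    apply antitoneOn_of_deriv_nonpos (convex_Icc 0 1)
    · exact fun t _ => (hd t).continuousAt.continuousWithinAt
    · exact fun t _ => (hd t).differentiableAt.differentiableWithinAt
    intro t ht
    rw [interior_Icc] at ht
    rw [(hd t).deriv]
    set R : Fin q → ℝ := fun a => P a + t * v a with hR
    have hR0 : ∀ a, 0 ≤ R a := by
      intro a
      simp only [hR, hv]
      split_ifs
      · have := hP a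
        have h1 := ht.1; have h2 := ht.2
        nlinarith [mul_nonneg h1.le hm0, mul_nonneg (sub_nonneg.2 h2.le) this]
      · simpa using hP a
    apply mul_nonpos_of_nonneg_of_nonpos (by positivity)
    have e : DD v MM = fun N => ∑ a, v a * (if a ∈ TT N then (1:ℝ) else 0) := by
      funext N; rw [DD_MM v hv0]; simp [Finset.sum_ite_mem]
    rw [e, EE_sum R v (fun a N => if a ∈ TT N then (1:ℝ) else 0)]
    set w : Fin q → ℝ := fun a => EE l R (fun N => if a ∈ TT N then (1:ℝ) else 0) with hw
    have hsub : ∑ a, v a * w a = ∑ a ∈ S, v a * w a := by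
      symm
      exact Finset.sum_subset (Finset.subset_univ _) (fun a _ ha => by simp [hv, ha])
    change ∑ a, v a * w a ≤ 0
    rw [hsub]
    have hav : AntivaryOn v w S := by
      intro i hi j hj hij
      by_contra hcon
      push Not at hcon
      have hi' : i ∈ S := hi
      have hj' : j ∈ S := hj
      have hPij : R j ≤ R i := by
        simp only [hR, hv, hi', hj', if_true] at hcon ⊢
        nlinarith [ht.1, ht.2]
      have := swap_le (l := l) R hR0 (fun _ => 1) (fun _ _ => zero_le_one) i j hPij
      exact absurd hij (not_lt.2 this)
    have := hav.card_mul_sum_le_sum_mul_sum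
    rw [hvS, zero_mul] at this
    by_contra hcon
    push Not at hcon
    have := mul_pos hc hcon
    linarith
  have := hanti (Set.left_mem_Icc.2 zero_le_one) (Set.right_mem_Icc.2 zero_le_one) zero_le_one
  simp only [zero_mul, add_zero, one_mul] at this
  refine le_trans (le_of_eq ?_) this
  congr 1
  funext a
  simp only [hv]; split_ifs <;> ring

/-- The distribution with mass `p` at `z`, uniform elsewhere. -/
noncomputable def QQ {q : ℕ} (z : Fin q) (p : ℝ) : Fin q → ℝ :=
  fun a => if a = z then p else (1 - p) / ((q : ℝ) - 1)

lemma DD2_lower {q l : ℕ} (hq : 2 ≤ q) (z : Fin q) (P : Fin q → ℝ) (hP : ∀ a, 0 ≤ P a)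
    (hz : ∀ a, P a ≤ P z) (v : Fin q → ℝ) (hv : ∀ a, v a = ((if a = z then (q:ℝ) else 0) - 1) / (q - 1)) :
    0 ≤ EE l P (DD v (DD v MM)) := by
  have hq' : (0:ℝ) < q - 1 := by
    have : (2:ℝ) ≤ q := by exact_mod_cast hq
    linarith
  have hsum : ∀ T : Finset (Fin q), ∑ a ∈ T, v a = ((if z ∈ T then (q:ℝ) else 0) - #T) / (q-1) := by
    intro T
    simp only [hv]
    rw [← Finset.sum_div, Finset.sum_sub_distrib, Finset.sum_ite_eq']
    simp
  have hsq : ∀ T : Finset (Fin q), ∑ a ∈ T, v a ^ 2 =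
      ((if z ∈ T then (q:ℝ)^2 - 2 * q else 0) + #T) / (q-1)^2 := by
    intro T
    have : ∀ a, v a ^ 2 = ((if a = z then (q:ℝ)^2 - 2 * q else 0) + 1) / (q-1)^2 := by
      intro a; rw [hv, div_pow]; split_ifs <;> ring
    simp only [this]
    rw [← Finset.sum_div, Finset.sum_add_distrib, Finset.sum_ite_eq']
    simp
  have hv0 : ∑ a, v a = 0 := by rw [hsum]; simp
  set h : ℕ → ℝ := fun n => ((n:ℝ) - 1) / (q-1)^2 with hh
  have hh0 : ∀ n, 1 ≤ n → 0 ≤ h n := by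
    intro n hn
    have : (1:ℝ) ≤ n := by exact_mod_cast hn
    exact div_nonneg (by linarith) (by positivity)
  have key : ∀ N : Fin q → ℕ, ∑ a : Fin q, (1:ℝ) * ((if z ∈ TT N then h #(TT N) else 0) -
      (if a ∈ TT N then h #(TT N) else 0)) ≤ DD v (DD v MM) N := by
    intro N
    refine le_trans ?_ (DD_DD_MM v hv0 N)
    have ht : (1:ℝ) ≤ #(TT N) := by
      obtain ⟨b, hb⟩ := exists_mx N z
      exact_mod_cast Finset.card_pos.2 ⟨b, (mem_TT N b).2 hb⟩
    rw [hsum, hsq]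
    simp only [one_mul, Finset.sum_sub_distrib, Finset.sum_const, Finset.sum_ite_mem,
      Finset.univ_inter, nsmul_eq_mul, Finset.card_univ, Fintype.card_fin, hh]
    rw [div_pow, ← sub_div]
    have e : ∀ x y : ℝ, x * (y / (q-1)^2) = x * y / (q-1)^2 := fun x y => by ring
    split_ifs
    · rw [e, e, ← sub_div]
      refine div_le_div_of_nonneg_right ?_ (by positivity)
      nlinarith [mul_nonneg (show (0:ℝ) ≤ q by positivity) (sub_nonneg.2 ht)]
    · rw [e, mul_zero, zero_sub, ← neg_div]
      refine div_le_div_of_nonneg_right ?_ (by positivity)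
      nlinarith
  refine le_trans ?_ (EE_mono P hP _ _ key)
  rw [EE_sum P (fun _ => 1) (fun a N => (if z ∈ TT N then h #(TT N) else 0) -
      (if a ∈ TT N then h #(TT N) else 0))]
  refine Finset.sum_nonneg fun a _ => ?_
  rw [one_mul, EE_sub]
  exact sub_nonneg.2 (swap_le P hP h hh0 z a (hz a))

lemma convex_QQ {q l : ℕ} (hq : 2 ≤ q) (z : Fin q) :
    ConvexOn ℝ (Set.Icc (1/(q:ℝ)) 1) (fun p => EE (l+2) (QQ z p) MM) := by
  have hq2 : (2:ℝ) ≤ q := by exact_mod_cast hq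
  have hq' : (0:ℝ) < q - 1 := by linarith
  set A : Fin q → ℝ := fun a => if a = z then 0 else 1 / (q - 1) with hA
  set v : Fin q → ℝ := fun a => ((if a = z then (q:ℝ) else 0) - 1) / (q - 1) with hv
  have hQ : ∀ p, QQ z p = fun a => A a + p * v a := by
    intro p; funext a
    simp only [QQ, hA, hv]
    split_ifs
    · field_simp; ring
    · field_simp; ring
  simp only [hQ]
  apply convexOn_of_hasDerivWithinAt2_nonneg (convex_Icc _ _)
    (f' := fun p => ((l + 1 : ℕ) + 1 : ℝ) * EE (l+1) (fun a => A a + p * v a) (DD v MM))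
    (f'' := fun p => ((l + 1 : ℕ) + 1 : ℝ) * ((l + 1 : ℝ) * EE l (fun a => A a + p * v a) (DD v (DD v MM))))
  · exact fun t _ => (hasDerivAt_EE A v t (l+1) MM).continuousAt.continuousWithinAt
  · exact fun t _ => (hasDerivAt_EE A v t (l+1) MM).hasDerivWithinAt
  · exact fun t _ => ((hasDerivAt_EE A v t l (DD v MM)).const_mul _).hasDerivWithinAt
  · intro t ht
    rw [interior_Icc] at ht
    rw [← hQ]
    have h0 : 0 < t := lt_trans (by positivity) ht.1
    have h1 : 1 ≤ t * q := by
      have := ht.1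
      rw [div_lt_iff₀ (by positivity)] at this
      exact this.le
    have := DD2_lower (l := l) hq z (QQ z t) ?_ ?_ v (fun a => rfl)
    · positivity
    · intro a; simp only [QQ]; split_ifs
      · exact h0.le
      · exact div_nonneg (by linarith [ht.2]) hq'.le
    · intro a; simp only [QQ]; split_ifs
      · exact le_rfl
      · rw [div_le_iff₀ hq']; nlinarith

/-- The bound for one coordinate. -/
lemma coord_bound {q l : ℕ} (hq : 2 ≤ q) (z y : Fin q) (P : Fin q → ℝ) (hP : IsDist P) :
    EE (l+1) (QQ z (max (P y) (1/(q:ℝ)))) MM ≤ EE (l+1) P MM := by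
  have hq2 : (2:ℝ) ≤ q := by exact_mod_cast hq
  have hq' : (0:ℝ) < q - 1 := by linarith
  rcases le_total (1/(q:ℝ)) (P y) with h | h
  · rw [max_eq_left h]
    have hcard : #(univ.erase y : Finset (Fin q)) = q - 1 := by simp
    have hne : (univ.erase y : Finset (Fin q)).Nonempty := by
      rw [← Finset.card_pos, hcard]; omega
    have e1 : EE (l+1) (QQ z (P y)) MM = EE (l+1) (QQ y (P y)) MM := by
      rw [EE_comp (QQ y (P y)) (Equiv.swap y z)]
      congr 1
      · funext a
        simp only [QQ, Function.comp, Equiv.swap_apply_eq_iff, Equiv.swap_apply_left]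
      · funext N; simp only [MM, mx_comp]
    rw [e1]
    refine le_trans (le_of_eq ?_) (schur (l := l) P hP.1 _ hne)
    congr 1
    funext a
    have hs : ∑ b ∈ univ.erase y, P b = 1 - P y := by
      have := Finset.add_sum_erase univ P (mem_univ y)
      rw [hP.2] at this; linarith
    rw [hs, hcard]
    by_cases ha : a = y
    · simp [QQ, ha]
    · simp [QQ, ha, Nat.cast_sub (show 1 ≤ q by omega)]
  · rw [max_eq_right h]
    refine le_trans (le_of_eq ?_) (schur (l := l) P hP.1 univ ⟨y, mem_univ y⟩)
    congr 1
    funext a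
    simp only [QQ, mem_univ, if_true, hP.2, Finset.card_univ, Fintype.card_fin]
    split_ifs
    · rfl
    · field_simp

lemma average_bound {q l n : ℕ} (hq : 2 ≤ q) (hn : 1 ≤ n) (z : Fin q) (P : Fin n → Fin q → ℝ)
    (hP : ∀ j, IsDist (P j)) (y : Fin n → Fin q) (p : ℝ) (hp1 : 1 / (q:ℝ) ≤ p)
    (h : n * p ≤ ∑ j, P j (y j)) :
    n * EE (l+2) (QQ z p) MM ≤ ∑ j, EE (l+2) (P j) MM := by
  have hn0 : (0:ℝ) < n := by exact_mod_cast hn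
  have hq2 : (2:ℝ) ≤ q := by exact_mod_cast hq
  set g : ℝ → ℝ := fun p => EE (l+2) (QQ z p) MM with hg
  have hconv : ConvexOn ℝ (Set.Icc (1/(q:ℝ)) 1) g := convex_QQ hq z
  have hq1 : 1 / (q:ℝ) ≤ 1 := by rw [div_le_one (by linarith)]; linarith
  set r : Fin n → ℝ := fun j => max (P j (y j)) (1/(q:ℝ)) with hr
  have hr1 : ∀ j, r j ∈ Set.Icc (1/(q:ℝ)) 1 := by
    intro j
    refine ⟨le_max_right _ _, max_le ?_ hq1⟩
    rw [← (hP j).2]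
    exact Finset.single_le_sum (fun a _ => (hP j).1 a) (mem_univ _)
  have hmin : ∀ s ∈ Set.Icc (1/(q:ℝ)) 1, g (1/(q:ℝ)) ≤ g s := by
    intro s hs
    have hD : IsDist (QQ z s) := by
      constructor
      · intro a; simp only [QQ]; split_ifs
        · exact le_trans (by positivity) hs.1
        · exact div_nonneg (by linarith [hs.2]) (by linarith)
      · rw [← Finset.add_sum_erase univ _ (mem_univ z),
          Finset.sum_congr rfl (g := fun _ => (1 - s) / ((q:ℝ) - 1))
            (fun a ha => by simp [QQ, Finset.ne_of_mem_erase ha])]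
        have : (q:ℝ) - 1 ≠ 0 := by linarith
        simp [QQ, Nat.cast_sub (show 1 ≤ q by omega)]
        field_simp; ring
    obtain ⟨y', hy'⟩ : ∃ y', QQ z s y' ≤ 1/(q:ℝ) := by
      by_contra hcon
      push Not at hcon
      have : ∑ a : Fin q, 1/(q:ℝ) < ∑ a, QQ z s a :=
        Finset.sum_lt_sum_of_nonempty ⟨z, mem_univ z⟩ (fun a _ => hcon a)
      rw [hD.2] at this
      simp at this
      rw [mul_inv_cancel₀ (by linarith)] at this
      exact lt_irrefl _ this
    have := coord_bound (l := l+1) hq z y' _ hD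
    rwa [max_eq_right hy'] at this
  have hj := hconv.map_sum_le (t := univ) (w := fun _ : Fin n => 1/(n:ℝ)) (p := r)
    (fun _ _ => by positivity) (by simp; field_simp) (fun j _ => hr1 j)
  simp only [smul_eq_mul, ← Finset.mul_sum] at hj
  set m := 1/(n:ℝ) * ∑ j, r j with hm
  have hpm : p ≤ m := by
    rw [hm, one_div, ← div_eq_inv_mul, le_div_iff₀ hn0]
    have : ∑ j, P j (y j) ≤ ∑ j, r j := Finset.sum_le_sum fun j _ => le_max_left _ _
    linarith
  have hm1 : m ≤ 1 := by
    rw [hm, one_div, ← div_eq_inv_mul, div_le_one hn0]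
    calc ∑ j, r j ≤ ∑ j : Fin n, (1:ℝ) := Finset.sum_le_sum fun j _ => (hr1 j).2
      _ = n := by simp
  have hmI : m ∈ Set.Icc (1/(q:ℝ)) 1 := ⟨hp1.trans hpm, hm1⟩
  have hgp : g p ≤ g m := by
    have := hconv.le_max_of_mem_Icc (x := 1/(q:ℝ)) (y := m) (z := p) ⟨le_rfl, hq1⟩ hmI ⟨hp1, hpm⟩
    rwa [max_eq_right (hmin m hmI)] at this
  have hfin : ∑ j, g (r j) ≤ ∑ j, EE (l+2) (P j) MM :=
    Finset.sum_le_sum fun j _ => coord_bound hq z (y j) (P j) (hP j)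
  have h3 : g p ≤ 1/(n:ℝ) * ∑ j, g (r j) := hgp.trans hj
  rw [one_div, ← div_eq_inv_mul, le_div_iff₀ hn0] at h3
  change n * g p ≤ _
  linarith

lemma maxOmega_unif {q L : ℕ} (hq : 2 ≤ q) (x : Fin L → Fin q) :
    maxOmega (fun _ : Fin L => 1 / (L : ℝ)) x = 1 / (L:ℝ) * MM (cnt x) := by
  have : Nonempty (Fin q) := ⟨⟨0, by omega⟩⟩
  have h : ∀ a, ∑ i ∈ univ.filter (fun i => x i = a), 1 / (L:ℝ) = 1 / (L:ℝ) * (cnt x a : ℝ) := by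
    intro a; simp [cnt, mul_comm]
  unfold maxOmega
  simp only [h]
  apply le_antisymm
  · refine ciSup_le fun a => ?_
    refine mul_le_mul_of_nonneg_left ?_ (by positivity)
    simp only [MM]
    exact_mod_cast le_mx _ a
  · obtain ⟨b, hb⟩ := exists_mx (cnt x) (Classical.arbitrary _)
    rw [MM, ← hb]
    exact le_ciSup (f := fun a => 1 / (L:ℝ) * (cnt x a : ℝ)) (Set.finite_range _).bddAbove b

lemma fF_unif {q L : ℕ} (hq : 2 ≤ q) (P : Fin q → ℝ) :
    fF P (fun _ : Fin L => 1 / (L : ℝ)) = 1 - 1 / (L:ℝ) * EE L P MM := by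
  simp only [fF, EE, maxOmega_unif hq, Finset.mul_sum]
  congr 1
  refine Finset.sum_congr rfl fun x _ => by ring

lemma le_maxOmega {q L : ℕ} (ω : Fin L → ℝ) (x : Fin L → Fin q) (a : Fin q) :
    ∑ i ∈ univ.filter (fun i => x i = a), ω i ≤ maxOmega ω x :=
  le_ciSup (f := fun a => ∑ i ∈ univ.filter (fun i => x i = a), ω i)
    (Set.finite_range _).bddAbove a

/-- symmetrization of the weights -/
lemma symm_weights {q L : ℕ} (hq : 2 ≤ q) (hL : 2 ≤ L) (P : Fin q → ℝ) (hP : ∀ a, 0 ≤ P a)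
    (ω : Fin L → ℝ) (hω : IsDist ω) :
    1 / (L:ℝ) * EE L P MM ≤ ∑ x : Fin L → Fin q, (∏ i, P (x i)) * maxOmega ω x := by
  have : NeZero L := ⟨by omega⟩
  have : Nonempty (Fin q) := ⟨⟨0, by omega⟩⟩
  have hL0 : (0:ℝ) < L := by exact_mod_cast (show 0 < L by omega)
  have hshift : ∀ s : Fin L, ∑ x : Fin L → Fin q, (∏ i, P (x i)) * maxOmega ω x =
      ∑ x : Fin L → Fin q, (∏ i, P (x i)) * maxOmega ω (fun i => x (i + s)) := by
    intro s
    rw [← (Equiv.arrowCongr (Equiv.addRight s).symm (Equiv.refl (Fin q))).sum_comp]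
    refine Finset.sum_congr rfl fun x _ => ?_
    have e : (Equiv.arrowCongr (Equiv.addRight s).symm (Equiv.refl (Fin q))) x
        = fun i => x (i + s) := by
      funext i; simp [Equiv.arrowCongr]
    rw [e]
    congr 1
    exact Equiv.prod_comp (Equiv.addRight s) (fun i => P (x i))
  have hpt : ∀ x : Fin L → Fin q, MM (cnt x) ≤ ∑ s : Fin L, maxOmega ω (fun i => x (i + s)) := by
    intro x
    obtain ⟨b, hb⟩ := exists_mx (cnt x) (Classical.arbitrary _)
    refine le_trans (le_of_eq ?_) (Finset.sum_le_sum fun s _ => le_maxOmega ω _ b)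
    simp only [Finset.sum_filter]
    rw [Finset.sum_comm]
    have : ∀ i : Fin L, ∑ s : Fin L, (if x (i + s) = b then ω i else 0) = ω i * (cnt x b : ℝ) := by
      intro i
      refine (Equiv.sum_comp (Equiv.addLeft i) (fun j => if x j = b then ω i else 0)).trans ?_
      rw [← Finset.sum_filter]
      simp [cnt, mul_comm]
    simp only [this]
    rw [← Finset.sum_mul, hω.2, one_mul, MM, hb]
  have h1 : (L:ℝ) * ∑ x : Fin L → Fin q, (∏ i, P (x i)) * maxOmega ω x =
      ∑ s : Fin L, ∑ x : Fin L → Fin q, (∏ i, P (x i)) * maxOmega ω (fun i => x (i + s)) := by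
    rw [Finset.sum_congr rfl (fun s _ => (hshift s).symm)]
    simp
  rw [one_div, ← div_eq_inv_mul, div_le_iff₀ hL0, mul_comm _ (L:ℝ), h1, Finset.sum_comm]
  unfold EE
  refine Finset.sum_le_sum fun x _ => ?_
  rw [← Finset.mul_sum]
  exact mul_le_mul_of_nonneg_left (hpt x) (Finset.prod_nonneg fun _ _ => hP _)

lemma phi_dist {q : ℕ} (b : Fin q) : IsDist (phi q b) := by
  constructor
  · intro a; simp only [phi]; split_ifs <;> norm_num
  · simp [phi]

lemma phi_l1 {q : ℕ} (a b : Fin q) :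
    (1/2 : ℝ) * ∑ k, |phi q a k - phi q b k| = 1 - if a = b then 1 else 0 := by
  by_cases h : a = b
  · simp [h]
  · have : ∀ k, |phi q a k - phi q b k| = (if k = a then 1 else 0) + (if k = b then 1 else 0) := by
      intro k
      simp only [phi]
      by_cases h1 : k = a <;> by_cases h2 : k = b
      · exact absurd (h1.symm.trans h2) h
      · subst h1; simp [h2]
      · subst h2; simp [h1]
      · simp [h1, h2]
    simp only [this, Finset.sum_add_distrib]
    simp [h]; norm_num

lemma radOmega_le {q n L : ℕ} (hq : 2 ≤ q) (ω : Fin L → ℝ) (hω : IsDist ω)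
    (cs : Fin L → Fin n → Fin q) :
    radOmega ω (fun i j => phi q (cs i j)) ≤
      1 / (n:ℝ) * ∑ j, (1 - maxOmega ω (fun i => cs i j)) := by
  have : Nonempty (Fin q) := ⟨⟨0, by omega⟩⟩
  unfold radOmega
  refine mul_le_mul_of_nonneg_left ?_ (by positivity)
  have hb : ∀ j, ∃ b, ∑ i ∈ univ.filter (fun i => cs i j = b), ω i = maxOmega ω (fun i => cs i j) :=
    fun j => exists_eq_ciSup_of_finite
  choose b hb using hb
  apply csInf_le
  · refine ⟨0, ?_⟩
    rintro r ⟨y, -, rfl⟩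
    refine Finset.sum_nonneg fun i _ => mul_nonneg (hω.1 i) ?_
    unfold dvec
    exact mul_nonneg (by norm_num) (Finset.sum_nonneg fun _ _ => Finset.sum_nonneg fun _ _ => abs_nonneg _)
  · refine ⟨fun j => phi q (b j), fun j => phi_dist _, ?_⟩
    simp only [dvec, Finset.mul_sum (s := (univ : Finset (Fin n))), phi_l1]
    rw [Finset.sum_comm]
    refine Finset.sum_congr rfl fun j _ => ?_
    simp only [mul_sub, Finset.sum_sub_distrib, mul_one, hω.2, mul_ite, mul_zero]
    rw [← hb, Finset.sum_filter]

/-- column distribution of a code -/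
noncomputable def col {q n : ℕ} (C : Finset (Fin n → Fin q)) (j : Fin n) : Fin q → ℝ :=
  fun a => (#(C.filter (fun c => c j = a)) : ℝ) / #C

lemma col_dist {q n : ℕ} (C : Finset (Fin n → Fin q)) (hC : C.Nonempty) (j : Fin n) :
    IsDist (col C j) := by
  have hc : (#C : ℝ) ≠ 0 := by exact_mod_cast hC.card_pos.ne'
  refine ⟨fun a => by unfold col; positivity, ?_⟩
  unfold col
  rw [← Finset.sum_div, div_eq_one_iff_eq hc]
  exact_mod_cast (Finset.card_eq_sum_card_fiberwise (f := fun c : Fin n → Fin q => c j)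
    (s := C) (t := univ) (fun _ _ => mem_coe.2 (mem_univ _))).symm

lemma col_avg {q n L : ℕ} (C : Finset (Fin n → Fin q)) (j : Fin n)
    (h : (Fin L → Fin q) → ℝ) :
    1 / (#C : ℝ) ^ L * ∑ cs ∈ Fintype.piFinset (fun _ : Fin L => C), h (fun i => cs i j) =
      ∑ x : Fin L → Fin q, (∏ i, col C j (x i)) * h x := by
  rw [← Finset.sum_fiberwise (Fintype.piFinset (fun _ : Fin L => C)) (fun cs i => cs i j),
    Finset.mul_sum]
  refine Finset.sum_congr rfl fun x _ => ?_
  have e : (Fintype.piFinset (fun _ : Fin L => C)).filter (fun cs => (fun i => cs i j) = x) =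
      Fintype.piFinset (fun i : Fin L => C.filter (fun c => c j = x i)) := by
    ext cs
    simp only [mem_filter, Fintype.mem_piFinset, funext_iff, forall_and]
  rw [Finset.sum_congr rfl (g := fun _ => h x)
    (fun cs hcs => by rw [(mem_filter.1 hcs).2]), Finset.sum_const, e, Fintype.card_piFinset]
  simp only [col, Finset.prod_div_distrib, Finset.prod_const, Finset.card_univ, Fintype.card_fin,
    nsmul_eq_mul, Nat.cast_prod]
  ring

lemma col_sum {q n : ℕ} (hn : 1 ≤ n) (hq : 2 ≤ q) (C : Finset (Fin n → Fin q)) (hC : C.Nonempty)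
    (p : ℝ) (hrad : radhCode C ≤ 1 - p) :
    ∃ y : Fin n → Fin q, n * p ≤ ∑ j, col C j (y j) := by
  have : Nonempty (Fin q) := ⟨⟨0, by omega⟩⟩
  have hn0 : (0:ℝ) < n := by exact_mod_cast hn
  have hc : (0 : ℝ) < #C := by exact_mod_cast hC.card_pos
  obtain ⟨y, hy⟩ := exists_eq_ciInf_of_finite
    (f := fun y : Fin n → Fin q => sSup {d : ℝ | ∃ c ∈ C, d = (hammingDist c y : ℝ)})
  refine ⟨y, ?_⟩
  unfold radhCode at hrad
  rw [← hy, one_div, ← div_eq_inv_mul, div_le_iff₀ hn0] at hrad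
  have hfin : {d : ℝ | ∃ c ∈ C, d = (hammingDist c y : ℝ)}.Finite := by
    refine ((C.finite_toSet).image (fun c => (hammingDist c y : ℝ))).subset ?_
    rintro d ⟨c, hc, rfl⟩
    exact ⟨c, hc, rfl⟩
  have hd : ∀ c ∈ C, (hammingDist c y : ℝ) ≤ (1 - p) * n := fun c hc =>
    (le_csSup hfin.bddAbove ⟨c, hc, rfl⟩).trans hrad
  have hd2 : ∀ c ∈ C, n * p ≤ ∑ j, if c j = y j then (1:ℝ) else 0 := by
    intro c hc
    have h1 := hd c hc
    have h2 : (hammingDist c y : ℝ) = n - ∑ j, if c j = y j then (1:ℝ) else 0 := by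
      have h3 := Finset.card_filter_add_card_filter_not (s := (univ : Finset (Fin n))) (fun j => c j = y j)
      simp only [Finset.card_univ, Fintype.card_fin] at h3
      rw [← Finset.sum_filter]
      simp only [Finset.sum_const, nsmul_eq_mul, mul_one, hammingDist]
      rw [eq_sub_iff_add_eq, add_comm]
      exact_mod_cast h3
    linarith
  have hs := Finset.sum_le_sum hd2
  rw [Finset.sum_comm] at hs
  simp only [Finset.sum_const, nsmul_eq_mul] at hs
  unfold col
  rw [← Finset.sum_div, le_div_iff₀ hc]
  simp only [Finset.card_filter]
  push_cast
  linarith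

end AvgRad

open AvgRad in
theorem average_radOmega_le_fF (q n L : ℕ) (hq : 2 ≤ q) (hn : 1 ≤ n) (hL : 2 ≤ L)
    (C : Finset (Fin n → Fin q)) (hC : C.Nonempty)
    (p : ℝ) (hp1 : 1 / (q : ℝ) ≤ p) (hp2 : p ≤ 1)
    (hrad : radhCode C ≤ 1 - p) :
    ∀ ω : Fin L → ℝ, IsDist ω →
      (1 / (C.card : ℝ) ^ L) *
          ∑ cs ∈ Fintype.piFinset (fun _ : Fin L => C),
            radOmega ω (fun i j => phi q (cs i j)) ≤
        fF (Pqp q p) (fun _ : Fin L => 1 / (L : ℝ)) := by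
  intro ω hω
  have hn0 : (0:ℝ) < n := by exact_mod_cast hn
  have hc : (0 : ℝ) < #C := by exact_mod_cast hC.card_pos
  obtain ⟨y, hy⟩ := col_sum hn hq C hC p hrad
  obtain ⟨l, rfl⟩ : ∃ l, L = l + 2 := ⟨L - 2, by omega⟩
  set z : Fin q := ⟨q - 1, by omega⟩ with hz
  have hPQ : Pqp q p = QQ z p := by
    funext a; simp only [Pqp, QQ, hz, Fin.ext_iff]
  have hav := average_bound (l := l) hq hn z (fun j => col C j) (fun j => col_dist C hC j) y p hp1 hy
  rw [fF_unif hq, hPQ]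
  set K := EE (l+2) (QQ z p) MM
  have h1 : (1 / (#C : ℝ) ^ (l+2)) * ∑ cs ∈ Fintype.piFinset (fun _ : Fin (l+2) => C),
      radOmega ω (fun i j => phi q (cs i j)) ≤ (1 / (#C : ℝ) ^ (l+2)) *
      ∑ cs ∈ Fintype.piFinset (fun _ : Fin (l+2) => C),
        (1 / (n:ℝ) * ∑ j, (1 - maxOmega ω (fun i => cs i j))) :=
    mul_le_mul_of_nonneg_left (Finset.sum_le_sum fun cs _ => radOmega_le hq ω hω cs) (by positivity)
  refine h1.trans ?_
  have h2 : (1 / (#C : ℝ) ^ (l+2)) * ∑ cs ∈ Fintype.piFinset (fun _ : Fin (l+2) => C),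
        (1 / (n:ℝ) * ∑ j, (1 - maxOmega ω (fun i => cs i j))) =
      1 / (n:ℝ) * ∑ j, ((1 / (#C : ℝ) ^ (l+2)) * ∑ cs ∈ Fintype.piFinset (fun _ : Fin (l+2) => C),
        (1 - maxOmega ω (fun i => cs i j))) := by
    rw [← Finset.mul_sum, ← Finset.mul_sum, Finset.sum_comm]; ring
  rw [h2]
  have h3 : ∀ j, ((1 / (#C : ℝ) ^ (l+2)) * ∑ cs ∈ Fintype.piFinset (fun _ : Fin (l+2) => C),
        (1 - maxOmega ω (fun i => cs i j))) ≤ 1 - 1 / ((l+2 : ℕ):ℝ) * EE (l+2) (col C j) MM := by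
    intro j
    rw [Finset.sum_sub_distrib, mul_sub, col_avg C j (maxOmega ω)]
    have e : (1 / (#C : ℝ) ^ (l+2)) * ∑ cs ∈ Fintype.piFinset (fun _ : Fin (l+2) => C), (1:ℝ) = 1 := by
      simp only [Finset.sum_const, Fintype.card_piFinset, Finset.prod_const, Finset.card_univ,
        Fintype.card_fin, nsmul_eq_mul, mul_one, Nat.cast_pow]
      field_simp
    rw [e]
    have := symm_weights hq hL (col C j) (col_dist C hC j).1 ω hω
    linarith
  have h4 := Finset.sum_le_sum (s := univ) fun j _ => h3 j
  rw [Finset.sum_sub_distrib] at h4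
  simp only [Finset.sum_const, Finset.card_univ, Fintype.card_fin, nsmul_eq_mul, mul_one] at h4
  rw [← Finset.mul_sum univ (fun j => EE (l+2) (col C j) MM)] at h4
  have h5 := mul_le_mul_of_nonneg_left hav (show 0 ≤ 1 / ((l+2 : ℕ):ℝ) by positivity)
  rw [one_div (n:ℝ), ← div_eq_inv_mul, div_le_iff₀ hn0]
  have e6 : (1 - 1 / ((l+2 : ℕ):ℝ) * K) * n = n - 1 / ((l+2 : ℕ):ℝ) * (n * K) := by ring
  rw [e6]
  linarith
end

section
/- Let q ≥ 3, 1 ≤ ℓ < q and L ≥ 2 be fixed integers. For every ε > 0 there exists δ > 0 with the following property: for every natural number s ≥ 1 there exist constants M₀ = M₀(s) and c = c(s) such that for every n ≥ 1 and every code C ⊆ [q]^n with |C| = M ≥ M₀, at least one of the following holds: (1) there exists a subcode C' ⊆ C with |C'| ≥ s and rad_ℓ(C') ≤ 1 − ℓ/q − δ; or (2) there exist at least M^L − c·M^{L−1} ordered L-tuples (c_1,...,c_L) of pairwise distinct codewords of C such that |type_u(c_1,...,c_L) − q^{−L}| ≤ ε for every u ∈ [q]^L, and consequently |rad_{ω,ℓ}(φ_ℓ(c_1),...,φ_ℓ(c_L))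 − f_ℓ(U_q,ω)| ≤ q^L ε for every probability distribution ω on [L]. -/
open Finset
open scoped Classical

/-- The collection `X` of `ℓ`-element subsets of `[q]`. -/
abbrev Subsets (q ℓ : ℕ) := {A : Finset (Fin q) // A.card = ℓ}

/-- The list-recovery distance between `x ∈ [q]^n` and a tuple of `ℓ`-subsets. -/
def dLR {q ℓ n : ℕ} (x : Fin n → Fin q) (Y : Fin n → Subsets q ℓ) : ℕ :=
  (Finset.univ.filter fun j => x j ∉ (Y j).1).card

/-- The `ℓ`-radius of a code: `rad_ℓ(C) = (1/n) min_{Y∈Xⁿ} max_{c∈C} d_LR(c,Y)`. -/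
noncomputable def radLCode {q n : ℕ} (ℓ : ℕ) (C : Finset (Fin n → Fin q)) : ℝ :=
  (1 / (n : ℝ)) * ⨅ Y : Fin n → Subsets q ℓ, sSup {d : ℝ | ∃ c ∈ C, d = (dLR c Y : ℝ)}

/-- The embedding `φ_ℓ : [q] → ∂Δ_ℓ`, `φ_ℓ(i) = ∑_{A∈X : i∈A} e_A`. -/
noncomputable def phiL (q ℓ : ℕ) (i : Fin q) : Subsets q ℓ → ℝ :=
  fun A => if i ∈ A.1 then 1 else 0

/-- `d(x,y) = ∑_j (1/2)(‖x(j) − y(j)‖₁ − C(q−1,ℓ−1) + 1)` on blocks in `ℝ^X`. -/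
noncomputable def dvecL {q ℓ n : ℕ} (x y : Fin n → Subsets q ℓ → ℝ) : ℝ :=
  ∑ j, (1 / 2) * ((∑ A : Subsets q ℓ, |x j A - y j A|) - ((q - 1).choose (ℓ - 1) : ℝ) + 1)

/-- The weighted average `ℓ`-radius `rad_{ω,ℓ}(x₁,…,x_L) = (1/n) inf_{y∈Δ_ℓⁿ} ∑_i ω(i) d(xᵢ,y)`. -/
noncomputable def radOmegaL {q ℓ n L : ℕ} (ω : Fin L → ℝ) (xs : Fin L → Fin n → Subsets q ℓ → ℝ) : ℝ :=
  (1 / (n : ℝ)) *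
    sInf {r : ℝ | ∃ y : Fin n → Subsets q ℓ → ℝ, (∀ j, IsDist (y j)) ∧ r = ∑ i, ω i * dvecL (xs i) y}

/-- `max_{ω,ℓ}(x₁,…,x_L) = max_{A∈X} ∑_{i : xᵢ ∈ A} ω(i)`. -/
noncomputable def maxOmegaL {q L : ℕ} (ℓ : ℕ) (ω : Fin L → ℝ) (x : Fin L → Fin q) : ℝ :=
  ⨆ A : Subsets q ℓ, ∑ i ∈ Finset.univ.filter (fun i => x i ∈ A.1), ω i

/-- `f_ℓ(P,ω) = 1 − ∑_{x∈[q]^L} (∏ᵢ P(xᵢ)) · max_{ω,ℓ}(x)`. -/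
noncomputable def fL {q L : ℕ} (ℓ : ℕ) (P : Fin q → ℝ) (ω : Fin L → ℝ) : ℝ :=
  1 - ∑ x : Fin L → Fin q, (∏ i, P (x i)) * maxOmegaL ℓ ω x

/-- `type_u(c₁,…,c_L) = (1/n)·|{i : (c₁(i),…,c_L(i)) = u}|`. -/
noncomputable def typeu {q n L : ℕ} (cs : Fin L → Fin n → Fin q) (u : Fin L → Fin q) : ℝ :=
  ((Finset.univ.filter fun j : Fin n => ∀ i, cs i j = u i).card : ℝ) / (n : ℝ)

lemma exists_sub_avg {q : ℕ} (w : Fin q → ℝ) (d : ℕ) : ∀ (S : Finset (Fin q)) (k : ℕ), S.card = k + d →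
    ∃ A ⊆ S, A.card = k ∧ (k : ℝ) * ∑ b ∈ S, w b ≤ (S.card : ℝ) * ∑ b ∈ A, w b := by
  induction d with
  | zero =>
    intro S k h
    exact ⟨S, Finset.Subset.refl _, by simpa using h, by rw [h]; simp⟩
  | succ d ih =>
    intro S k h
    have hne : S.Nonempty := Finset.card_pos.mp (by omega)
    obtain ⟨a, ha, hmin⟩ := Finset.exists_min_image S w hne
    have hc : (S.erase a).card = k + d := by rw [Finset.card_erase_of_mem ha]; omega
    obtain ⟨A, hA, hAc, hle⟩ := ih (S.erase a) k hc
    refine ⟨A, hA.trans (Finset.erase_subset _ _), hAc, ?_⟩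
    have hsum : ∑ b ∈ S, w b = w a + ∑ b ∈ S.erase a, w b := (Finset.add_sum_erase S w ha).symm
    have hmina : ((k + d : ℕ) : ℝ) * w a ≤ ∑ b ∈ S.erase a, w b := by
      have := Finset.card_nsmul_le_sum (S.erase a) w (w a) (fun b hb => hmin b (Finset.mem_of_mem_erase hb))
      rw [hc, nsmul_eq_mul] at this
      exact this
    have hminA : (k : ℝ) * w a ≤ ∑ b ∈ A, w b := by
      have := Finset.card_nsmul_le_sum A w (w a) (fun b hb => hmin b (Finset.mem_of_mem_erase (hA hb)))
      rw [hAc, nsmul_eq_mul] at this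
      exact this
    rw [hc] at hle
    rw [h, hsum]
    push_cast at *
    nlinarith

lemma exists_top {q ℓ : ℕ} (hlq : ℓ < q) (w : Fin q → ℝ) :
    ∃ A : Subsets q ℓ, (ℓ : ℝ) / q * ∑ b, w b ≤ ∑ b ∈ A.1, w b := by
  obtain ⟨A, -, hA, h⟩ := exists_sub_avg w (q - ℓ) Finset.univ ℓ (by simp; omega)
  refine ⟨⟨A, hA⟩, ?_⟩
  have hq : (0 : ℝ) < q := by exact_mod_cast (by omega : 0 < q)
  simp only [Finset.card_univ, Fintype.card_fin] at h
  rw [div_mul_eq_mul_div, div_le_iff₀ hq]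
  linarith

lemma exists_top_mem {q ℓ : ℕ} (hq : 2 ≤ q) (hl1 : 1 ≤ ℓ) (hlq : ℓ < q) (w : Fin q → ℝ) (b : Fin q) :
    ∃ A : Subsets q ℓ, (ℓ : ℝ) / q * ∑ b, w b + (w b - (∑ b, w b) / q) / q ≤ ∑ b ∈ A.1, w b ∨
      w b ≤ (∑ b, w b) / q := by
  by_cases hwb : w b ≤ (∑ b, w b) / q
  · obtain ⟨A, -⟩ := exists_top hlq w
    exact ⟨A, Or.inr hwb⟩
  obtain ⟨A, hs, hA, h⟩ := exists_sub_avg w (q - ℓ) (Finset.univ.erase b) (ℓ - 1)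
    (by rw [Finset.card_erase_of_mem (Finset.mem_univ _)]; simp; omega)
  have hb : b ∉ A := fun hb => by simpa using hs hb
  refine ⟨⟨insert b A, by rw [Finset.card_insert_of_notMem hb]; omega⟩, Or.inl ?_⟩
  have hq0 : (0 : ℝ) < q := by exact_mod_cast (by omega : 0 < q)
  rw [Finset.sum_insert hb]
  have hsum := Finset.add_sum_erase Finset.univ w (Finset.mem_univ b)
  rw [Finset.card_erase_of_mem (Finset.mem_univ _)] at h
  simp only [Finset.card_univ, Fintype.card_fin] at h
  rw [Nat.cast_sub hl1, Nat.cast_sub (by omega)] at h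
  have h1 : (ℓ : ℝ) + 1 ≤ q := by exact_mod_cast hlq
  have h2 : (1 : ℝ) ≤ ℓ := by exact_mod_cast hl1
  generalize hW : ∑ b, w b = W at *
  generalize ∑ b ∈ A, w b = T at *
  have hE : ∑ x ∈ Finset.univ.erase b, w x = W - w b := by linarith
  rw [hE] at h
  push_cast at h
  push Not at hwb
  rw [div_lt_iff₀ hq0] at hwb
  have hd : (ℓ : ℝ) / q * W + (w b - W / q) / q = (ℓ * W * q + (w b * q - W)) / (q * q) := by
    field_simp
  rw [hd, div_le_iff₀ (by positivity)]
  have hq1 : (0 : ℝ) < (q : ℝ) - 1 := by linarith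
  -- multiply by q - 1
  have key : (q - 1 : ℝ) * (ℓ * W * q + (w b * q - W)) ≤ (q - 1 : ℝ) * ((w b + T) * (q * q)) := by
    have e1 : (q * q : ℝ) * (((ℓ : ℝ) - 1) * (W - w b)) ≤ (q * q : ℝ) * (((q : ℝ) - 1) * T) :=
      mul_le_mul_of_nonneg_left h (by positivity)
    have e2 : 0 ≤ (w b * q - W) * (q * ((q : ℝ) - ℓ) - (q - 1)) := by
      apply mul_nonneg (by linarith)
      nlinarith
    nlinarith
  exact le_of_mul_le_mul_left key hq1

lemma near_uniform {V : Type*} [Fintype V] {q ℓ : ℕ} (hq : 2 ≤ q) (hl1 : 1 ≤ ℓ) (hlq : ℓ < q)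
    (w : V → Fin q → ℝ) (δ : ℝ) (hδ : 0 ≤ δ)
    (h : ∀ g : V → Subsets q ℓ, ∑ v, ∑ b ∈ (g v).1, w v b < (ℓ : ℝ) / q * (∑ v, ∑ b, w v b) + δ)
    (v : V) (b : Fin q) : |w v b - (∑ b, w v b) / q| ≤ q ^ 2 * δ := by
  have hq0 : (0 : ℝ) < q := by exact_mod_cast (by omega : 0 < q)
  have hq1 : (1 : ℝ) ≤ q := by exact_mod_cast (by omega : 1 ≤ q)
  have hA : ∀ A : Subsets q ℓ, ∑ b ∈ A.1, w v b ≤ (ℓ : ℝ) / q * ∑ b, w v b + δ := by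
    intro A
    choose g hg using fun v => exists_top hlq (w v)
    have h1 := h (Function.update g v A)
    rw [← Finset.add_sum_erase _ _ (Finset.mem_univ v), Finset.mul_sum,
      ← Finset.add_sum_erase (a := v) Finset.univ (fun i => (ℓ : ℝ) / q * ∑ b, w i b) (Finset.mem_univ v)] at h1
    have h2 : ∑ x ∈ Finset.univ.erase v, (ℓ : ℝ) / q * ∑ b, w x b ≤
        ∑ x ∈ Finset.univ.erase v, ∑ b ∈ (Function.update g v A x).1, w x b := by
      apply Finset.sum_le_sum
      intro x hx
      rw [Function.update_of_ne (Finset.ne_of_mem_erase hx)]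
      exact hg x
    simp only [Function.update_self] at h1
    linarith
  have hup : ∀ b, w v b - (∑ b, w v b) / q ≤ q * δ := by
    intro b
    obtain ⟨A, hA'⟩ := exists_top_mem hq hl1 hlq (w v) b
    rcases hA' with h1 | h1
    · have := hA A
      have h3 : (w v b - (∑ b, w v b) / q) / q ≤ δ := by linarith
      rw [div_le_iff₀ hq0] at h3
      linarith
    · have : 0 ≤ q * δ := by positivity
      linarith
  rw [abs_le]
  constructor
  · have hs : ∑ b, (w v b - (∑ b, w v b) / q) = 0 := by
      rw [Finset.sum_sub_distrib]
      simp
      field_simp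
      simp
    rw [← Finset.add_sum_erase _ _ (Finset.mem_univ b)] at hs
    have h2 : ∑ b ∈ Finset.univ.erase b, (w v b - (∑ b, w v b) / q) ≤ q * (q * δ) := by
      refine (Finset.sum_le_card_nsmul _ _ (q * δ) (fun b _ => hup b)).trans ?_
      rw [nsmul_eq_mul]
      apply mul_le_mul_of_nonneg_right _ (by positivity)
      have : (Finset.univ.erase b).card ≤ q := by
        simpa using Finset.card_le_univ (Finset.univ.erase b)
      exact_mod_cast this
    nlinarith
  · refine (hup b).trans ?_
    nlinarith [mul_nonneg (mul_nonneg hq0.le hδ) (sub_nonneg.2 hq1)]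

/-- Weighted sum over types equals normalized sum over positions. -/
lemma sum_typeu {q n L : ℕ} (cs : Fin L → Fin n → Fin q) (F : (Fin L → Fin q) → ℝ) :
    ∑ u, typeu cs u * F u = (∑ j, F (fun i => cs i j)) / n := by
  have h : ∀ u, typeu cs u * F u = (∑ j, if (fun i => cs i j) = u then F u else 0) / n := by
    intro u
    unfold typeu
    rw [← Finset.sum_filter, Finset.sum_const, nsmul_eq_mul]
    have : (Finset.univ.filter fun j : Fin n => ∀ i, cs i j = u i) =
        Finset.univ.filter fun j : Fin n => (fun i => cs i j) = u := by
      ext j; simp [funext_iff]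
    rw [this]; ring
  simp_rw [h]
  rw [← Finset.sum_div, Finset.sum_comm]
  simp

def TGood {q n L : ℕ} (ε : ℝ) (cs : Fin L → Fin n → Fin q) : Prop :=
  ∀ u : Fin L → Fin q, |typeu cs u - 1 / (q : ℝ) ^ L| ≤ ε

lemma typeu_cons_sum {q n k : ℕ} (xs : Fin k → Fin n → Fin q) (y : Fin n → Fin q) (v : Fin k → Fin q) :
    ∑ b, typeu (Fin.cons y xs : Fin (k+1) → Fin n → Fin q) (Fin.cons b v : Fin (k+1) → Fin q) = typeu xs v := by
  unfold typeu
  rw [← Finset.sum_div]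
  congr 1
  rw [← Nat.cast_sum]
  congr 1
  rw [Finset.card_eq_sum_card_fiberwise (f := y) (t := Finset.univ) (by simp)]
  apply Finset.sum_congr rfl
  intro b _
  congr 1
  ext j
  simp [Fin.forall_fin_succ, and_comm]

lemma sum_g {q ℓ n k : ℕ} (xs : Fin k → Fin n → Fin q) (y : Fin n → Fin q) (g : (Fin k → Fin q) → Subsets q ℓ) :
    ∑ v, ∑ b ∈ (g v).1, typeu (Fin.cons y xs : Fin (k+1) → Fin n → Fin q) (Fin.cons b v : Fin (k+1) → Fin q)
      = ((Finset.univ.filter fun j => y j ∈ (g (fun i => xs i j)).1).card : ℝ) / n := by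
  have h := sum_typeu (Fin.cons y xs : Fin (k+1) → Fin n → Fin q)
    (fun u => if u 0 ∈ (g (fun i => u i.succ)).1 then 1 else 0)
  simp only [Fin.cons_zero, Fin.cons_succ] at h
  rw [Finset.sum_boole] at h
  rw [← h, ← (Fin.consEquiv (fun _ => Fin q)).sum_comp, Fintype.sum_prod_type, Finset.sum_comm' (s' := fun b => Finset.univ.filter fun v => b ∈ (g v).1) (t' := Finset.univ) (by simp)]
  apply Finset.sum_congr rfl
  intro b _
  rw [Finset.sum_filter]
  apply Finset.sum_congr rfl
  intro v _
  simp [Fin.consEquiv]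

lemma bad_ext {q ℓ n k : ℕ} (hq : 2 ≤ q) (hl1 : 1 ≤ ℓ) (hlq : ℓ < q) (hn : 1 ≤ n)
    (ε δ : ℝ) (hδ : 0 ≤ δ) (hδε : q ^ 2 * δ ≤ ε / 2)
    (xs : Fin k → Fin n → Fin q) (hxs : TGood (ε / 2) xs) (y : Fin n → Fin q)
    (hy : ¬ TGood ε (Fin.cons y xs : Fin (k+1) → Fin n → Fin q)) :
    ∃ g : (Fin k → Fin q) → Subsets q ℓ,
      (dLR y (fun j => g (fun i => xs i j)) : ℝ) ≤ n * (1 - (ℓ : ℝ) / q - δ) := by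
  have hn0 : (0 : ℝ) < n := by exact_mod_cast hn
  have hq0 : (0 : ℝ) < q := by exact_mod_cast (by omega : 0 < q)
  have hq1 : (1 : ℝ) ≤ q := by exact_mod_cast (by omega : 1 ≤ q)
  by_contra hcon
  push Not at hcon
  apply hy
  intro u
  have htot : ∑ v : Fin k → Fin q, typeu xs v = 1 := by
    have := sum_typeu xs (fun _ => 1)
    simp at this
    rw [this]; field_simp
  have := near_uniform hq hl1 hlq (fun v b => typeu (Fin.cons y xs : Fin (k+1) → Fin n → Fin q) (Fin.cons b v : Fin (k+1) → Fin q)) δ hδ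
    (by
      intro g
      rw [sum_g]
      simp_rw [typeu_cons_sum]
      rw [htot, div_lt_iff₀ hn0]
      have h1 := hcon g
      have h2 := Finset.card_filter_add_card_filter_not (s := (Finset.univ : Finset (Fin n))) (fun j => y j ∈ (g (fun i => xs i j)).1)
      unfold dLR at h1
      simp only [Finset.card_univ, Fintype.card_fin] at h2
      have h3 : ((Finset.univ.filter fun j => y j ∈ (g (fun i => xs i j)).1).card : ℝ) +
        ((Finset.univ.filter fun j => y j ∉ (g (fun i => xs i j)).1).card : ℝ) = n := by exact_mod_cast h2
      linarith) (Fin.tail u) (u 0)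
  simp only [typeu_cons_sum, Fin.cons_self_tail] at this
  have h2 := hxs (Fin.tail u)
  have h3 : |typeu xs (Fin.tail u) / q - 1 / (q : ℝ) ^ (k + 1)| ≤ ε / 2 := by
    have : typeu xs (Fin.tail u) / q - 1 / (q : ℝ) ^ (k + 1) = (typeu xs (Fin.tail u) - 1 / (q : ℝ) ^ k) / q := by
      field_simp
      ring
    rw [this, abs_div, abs_of_pos hq0, div_le_iff₀ hq0]
    have : 0 ≤ ε / 2 := (abs_nonneg _).trans h2
    nlinarith
  have h4 := abs_sub_le (typeu (Fin.cons y xs : Fin (k+1) → Fin n → Fin q) u) (typeu xs (Fin.tail u) / q) (1 / (q : ℝ) ^ (k + 1))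
  linarith

lemma rad_le {q ℓ n : ℕ} (hn : 1 ≤ n) (C : Finset (Fin n → Fin q)) (hC : C.Nonempty) (Y : Fin n → Subsets q ℓ)
    (r : ℝ) (h : ∀ c ∈ C, (dLR c Y : ℝ) ≤ n * r) : radLCode ℓ C ≤ r := by
  have hn0 : (0 : ℝ) < n := by exact_mod_cast hn
  unfold radLCode
  rw [one_div, inv_mul_le_iff₀ hn0]
  refine (ciInf_le (Set.finite_range _).bddBelow Y).trans ?_
  obtain ⟨c, hc⟩ := hC
  have hne : {d : ℝ | ∃ c ∈ C, d = (dLR c Y : ℝ)}.Nonempty := ⟨(dLR c Y : ℝ), c, hc, rfl⟩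
  refine csSup_le hne ?_
  rintro _ ⟨c, hc, rfl⟩
  exact h c hc

lemma few_bad (q ℓ : ℕ) (hq : 2 ≤ q) (hl1 : 1 ≤ ℓ) (hlq : ℓ < q) (k : ℕ) :
    ∀ ε : ℝ, 0 < ε → ∃ δ : ℝ, 0 < δ ∧ ∀ s : ℕ, 1 ≤ s → ∃ c : ℕ,
      ∀ n : ℕ, 1 ≤ n → ∀ C : Finset (Fin n → Fin q),
        ((∃ C' ⊆ C, s ≤ C'.card ∧ radLCode ℓ C' ≤ 1 - (ℓ : ℝ) / (q : ℝ) - δ) ∨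
          ((Fintype.piFinset fun _ : Fin k => C).filter fun cs => ¬ TGood ε cs).card * C.card ≤ c * C.card ^ k) := by
  induction k with
  | zero =>
    intro ε hε
    refine ⟨1, one_pos, fun s _ => ⟨0, fun n hn C => Or.inr ?_⟩⟩
    have : ((Fintype.piFinset fun _ : Fin 0 => C).filter fun cs => ¬ TGood ε cs) = ∅ := by
      apply Finset.filter_false_of_mem
      intro cs _
      rw [not_not]
      intro u
      have hn0 : (n : ℝ) ≠ 0 := by exact_mod_cast (by omega : n ≠ 0)
      simp [typeu, hn0, hε.le]
    rw [this]; simp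
  | succ k ih =>
    intro ε hε
    have hq0 : (0 : ℝ) < q := by exact_mod_cast (by omega : 0 < q)
    obtain ⟨δ₀, hδ₀, H⟩ := ih (ε / 2) (by linarith)
    set δ := min δ₀ (ε / (2 * q ^ 2)) with hδdef
    have hδ : 0 < δ := lt_min hδ₀ (by positivity)
    have hδε : q ^ 2 * δ ≤ ε / 2 := by
      have : δ ≤ ε / (2 * q ^ 2) := min_le_right _ _
      rw [le_div_iff₀ (by positivity)] at this
      linarith
    refine ⟨δ, hδ, fun s hs => ?_⟩
    obtain ⟨c, Hc⟩ := H s hs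
    set G := Fintype.card ((Fin k → Fin q) → Subsets q ℓ) with hG
    refine ⟨c + G * s, fun n hn C => ?_⟩
    rcases Hc n hn C with ⟨C', h1, h2, h3⟩ | hb
    · exact Or.inl ⟨C', h1, h2, h3.trans (by linarith [min_le_left δ₀ (ε / (2 * q ^ 2))])⟩
    by_cases hcase : ∃ C' ⊆ C, s ≤ C'.card ∧ radLCode ℓ C' ≤ 1 - (ℓ : ℝ) / (q : ℝ) - δ
    · exact Or.inl hcase
    right
    -- few bad extensions of good prefixes
    have hext : ∀ xs : Fin k → Fin n → Fin q, TGood (ε / 2) xs →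
        (C.filter fun y => ¬ TGood ε (Fin.cons y xs : Fin (k+1) → Fin n → Fin q)).card ≤ G * s := by
      intro xs hxs
      by_contra hlt
      push Not at hlt
      set B := C.filter fun y => ¬ TGood ε (Fin.cons y xs : Fin (k+1) → Fin n → Fin q) with hB
      have hex : ∀ y : Fin n → Fin q, ∃ g : (Fin k → Fin q) → Subsets q ℓ, y ∈ B →
          (dLR y (fun j => g (fun i => xs i j)) : ℝ) ≤ n * (1 - (ℓ : ℝ) / q - δ) := by
        intro y
        by_cases hy : y ∈ B
        · obtain ⟨g, hg⟩ := bad_ext hq hl1 hlq hn ε δ hδ.le hδε xs hxs y (Finset.mem_filter.mp hy).2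
          exact ⟨g, fun _ => hg⟩
        · obtain ⟨A, -⟩ := exists_top hlq (fun _ : Fin q => (0 : ℝ))
          exact ⟨fun _ => A, fun h => absurd h hy⟩
      choose g hg using hex
      obtain ⟨g₀, -, hg₀⟩ := Finset.exists_lt_card_fiber_of_mul_lt_card_of_maps_to (s := B) (t := Finset.univ)
        (f := g) (n := s) (fun _ _ => Finset.mem_univ _) (by rwa [Finset.card_univ])
      apply hcase
      refine ⟨B.filter fun y => g y = g₀, (Finset.filter_subset _ _).trans (Finset.filter_subset _ _), hg₀.le, ?_⟩
      apply rad_le hn _ (Finset.card_pos.mp (by omega)) (fun j => g₀ (fun i => xs i j))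
      intro y hy
      rw [Finset.mem_filter] at hy
      have := hg y hy.1
      rwa [hy.2] at this
    set Bk := (Fintype.piFinset fun _ : Fin k => C).filter fun cs => ¬ TGood (ε / 2) cs with hBk
    set Gk := (Fintype.piFinset fun _ : Fin k => C).filter fun cs => TGood (ε / 2) cs with hGk
    have hsub : ((Fintype.piFinset fun _ : Fin (k+1) => C).filter fun cs => ¬ TGood ε cs) ⊆
        (Bk ×ˢ C).image (fun p => (Fin.cons p.2 p.1 : Fin (k+1) → Fin n → Fin q)) ∪
        Gk.biUnion (fun xs => (C.filter fun y => ¬ TGood ε (Fin.cons y xs : Fin (k+1) → Fin n → Fin q)).image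
          (fun y => (Fin.cons y xs : Fin (k+1) → Fin n → Fin q))) := by
      intro cs hcs
      rw [Finset.mem_filter, Fintype.mem_piFinset] at hcs
      obtain ⟨hm, hbad⟩ := hcs
      have ht : Fin.tail cs ∈ Fintype.piFinset fun _ : Fin k => C :=
        Fintype.mem_piFinset.mpr fun i => hm i.succ
      rw [Finset.mem_union]
      by_cases hgood : TGood (ε / 2) (Fin.tail cs)
      · right
        rw [Finset.mem_biUnion]
        refine ⟨Fin.tail cs, Finset.mem_filter.mpr ⟨ht, hgood⟩, Finset.mem_image.mpr ⟨cs 0, ?_, Fin.cons_self_tail cs⟩⟩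
        rw [Finset.mem_filter, Fin.cons_self_tail]
        exact ⟨hm 0, hbad⟩
      · left
        refine Finset.mem_image.mpr ⟨(Fin.tail cs, cs 0), ?_, Fin.cons_self_tail cs⟩
        exact Finset.mem_product.mpr ⟨Finset.mem_filter.mpr ⟨ht, hgood⟩, hm 0⟩
    have hGkc : Gk.card ≤ C.card ^ k := by
      refine (Finset.card_filter_le _ _).trans ?_
      simp
    have hcard : ((Fintype.piFinset fun _ : Fin (k+1) => C).filter fun cs => ¬ TGood ε cs).card ≤
        c * C.card ^ k + C.card ^ k * (G * s) := by
      refine (Finset.card_le_card hsub).trans ((Finset.card_union_le _ _).trans ?_)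
      apply Nat.add_le_add
      · refine Finset.card_image_le.trans ?_
        rw [Finset.card_product]
        exact hb
      · refine (Finset.card_biUnion_le_card_mul _ _ (G * s) ?_).trans (Nat.mul_le_mul_right _ hGkc)
        intro xs hxs
        exact Finset.card_image_le.trans (hext xs (Finset.mem_filter.mp hxs).2)
    calc _ ≤ (c * C.card ^ k + C.card ^ k * (G * s)) * C.card := Nat.mul_le_mul_right _ hcard
      _ = (c + G * s) * C.card ^ (k + 1) := by ring

lemma card_subsets_mem {q ℓ : ℕ} (hl1 : 1 ≤ ℓ) (i : Fin q) :
    (Finset.univ.filter fun A : Subsets q ℓ => i ∈ A.1).card = (q - 1).choose (ℓ - 1) := by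
  have h : (Finset.univ.erase i).card = q - 1 := by
    rw [Finset.card_erase_of_mem (Finset.mem_univ _)]; simp
  rw [← h, ← Finset.card_powersetCard]
  refine Finset.card_bij (fun A _ => A.1.erase i) ?_ ?_ ?_
  · intro A hA
    simp only [Finset.mem_filter, Finset.mem_univ, true_and] at hA
    rw [Finset.mem_powersetCard]
    exact ⟨Finset.erase_subset_erase _ (Finset.subset_univ _), by rw [Finset.card_erase_of_mem hA, A.2]⟩
  · intro A hA B hB hAB
    simp only [Finset.mem_filter, Finset.mem_univ, true_and] at hA hB
    apply Subtype.ext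
    rw [← Finset.insert_erase hA, ← Finset.insert_erase hB, hAB]
  · intro S hS
    rw [Finset.mem_powersetCard] at hS
    have hi : i ∉ S := fun hi => by simpa using hS.1 hi
    refine ⟨⟨insert i S, by rw [Finset.card_insert_of_notMem hi, hS.2]; omega⟩, by simp, ?_⟩
    simp [hi]

lemma d_single {q ℓ : ℕ} (hl1 : 1 ≤ ℓ) (i : Fin q) (y : Subsets q ℓ → ℝ) (hy : IsDist y) :
    (1 / 2 : ℝ) * ((∑ A : Subsets q ℓ, |phiL q ℓ i A - y A|) - ((q - 1).choose (ℓ - 1) : ℝ) + 1)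
      = 1 - ∑ A : Subsets q ℓ, y A * (if i ∈ A.1 then 1 else 0) := by
  have hle : ∀ A, y A ≤ 1 := fun A => by
    rw [← hy.2]; exact Finset.single_le_sum (fun a _ => hy.1 a) (Finset.mem_univ A)
  have h : ∀ A : Subsets q ℓ, |phiL q ℓ i A - y A| = (if i ∈ A.1 then (1 : ℝ) else 0) + y A
      - 2 * (y A * (if i ∈ A.1 then 1 else 0)) := by
    intro A
    unfold phiL
    split_ifs
    · rw [abs_of_nonneg (by linarith [hle A])]; ring
    · rw [abs_of_nonpos (by linarith [hy.1 A])]; ring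
  simp_rw [h]
  rw [Finset.sum_sub_distrib, Finset.sum_add_distrib, hy.2, Finset.sum_boole, card_subsets_mem hl1, ← Finset.mul_sum]
  ring

lemma radOmega_eq {q ℓ n L : ℕ} (hl1 : 1 ≤ ℓ) (hlq : ℓ < q) (hn : 1 ≤ n) (ω : Fin L → ℝ) (hω : IsDist ω)
    (cs : Fin L → Fin n → Fin q) :
    radOmegaL ω (fun i j => phiL q ℓ (cs i j)) = 1 - ∑ u, typeu cs u * maxOmegaL ℓ ω u := by
  have hn0 : (0 : ℝ) < n := by exact_mod_cast hn
  obtain ⟨A₀, -⟩ := exists_top hlq (fun _ : Fin q => (0 : ℝ))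
  haveI : Nonempty (Subsets q ℓ) := ⟨A₀⟩
  set S : (Fin L → Fin q) → Subsets q ℓ → ℝ := fun u A => ∑ i ∈ Finset.univ.filter (fun i => u i ∈ A.1), ω i with hS
  have hval : ∀ y : Fin n → Subsets q ℓ → ℝ, (∀ j, IsDist (y j)) →
      ∑ i, ω i * dvecL (fun j => phiL q ℓ (cs i j)) y = ∑ j, (1 - ∑ A, y j A * S (fun i => cs i j) A) := by
    intro y hy
    unfold dvecL
    simp_rw [d_single hl1 _ _ (hy _), Finset.mul_sum]
    rw [Finset.sum_comm]
    apply Finset.sum_congr rfl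
    intro j _
    simp_rw [mul_sub, mul_one, Finset.sum_sub_distrib, hω.2, Finset.mul_sum]
    rw [Finset.sum_comm]
    congr 1
    apply Finset.sum_congr rfl
    intro A _
    simp only [hS]
    rw [Finset.sum_filter, Finset.mul_sum]
    apply Finset.sum_congr rfl
    intro i _
    split_ifs <;> ring
  have hleast : IsLeast {r : ℝ | ∃ y : Fin n → Subsets q ℓ → ℝ, (∀ j, IsDist (y j)) ∧
      r = ∑ i, ω i * dvecL ((fun i j => phiL q ℓ (cs i j)) i) y} (∑ j, (1 - maxOmegaL ℓ ω (fun i => cs i j))) := by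
    constructor
    · choose A hA using fun j : Fin n => exists_eq_ciSup_of_finite (f := S (fun i => cs i j))
      have hd : ∀ j, IsDist (fun B => if B = A j then (1 : ℝ) else 0) := by
        intro j
        constructor
        · intro a; dsimp only; split_ifs <;> norm_num
        · simp
      refine ⟨fun j B => if B = A j then 1 else 0, hd, ?_⟩
      rw [hval _ hd]
      apply Finset.sum_congr rfl
      intro j _
      simp [hA, maxOmegaL, hS]
      exact (hA j).symm
    · rintro r ⟨y, hy, rfl⟩
      rw [hval y hy]
      apply Finset.sum_le_sum
      intro j _
      have : ∑ A, y j A * S (fun i => cs i j) A ≤ ∑ A, y j A * maxOmegaL ℓ ω (fun i => cs i j) := by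
        apply Finset.sum_le_sum
        intro A _
        apply mul_le_mul_of_nonneg_left _ ((hy j).1 A)
        exact le_ciSup (f := S (fun i => cs i j)) (Set.finite_range _).bddAbove A
      rw [← Finset.sum_mul, (hy j).2, one_mul] at this
      linarith
  unfold radOmegaL
  rw [hleast.csInf_eq, sum_typeu, Finset.sum_sub_distrib]
  simp
  field_simp

lemma maxOmega_bd {q ℓ L : ℕ} (hlq : ℓ < q) (ω : Fin L → ℝ) (hω : IsDist ω) (u : Fin L → Fin q) :
    |maxOmegaL ℓ ω u| ≤ 1 := by
  obtain ⟨A₀, -⟩ := exists_top hlq (fun _ : Fin q => (0 : ℝ))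
  haveI : Nonempty (Subsets q ℓ) := ⟨A₀⟩
  unfold maxOmegaL
  rw [abs_of_nonneg (Real.iSup_nonneg fun A => Finset.sum_nonneg fun i _ => hω.1 i)]
  apply ciSup_le
  intro A
  rw [← hω.2]
  exact Finset.sum_le_sum_of_subset_of_nonneg (Finset.filter_subset _ _) (fun i _ _ => hω.1 i)

lemma omega_conseq {q ℓ n L : ℕ} (hl1 : 1 ≤ ℓ) (hlq : ℓ < q) (hn : 1 ≤ n) (ε : ℝ)
    (cs : Fin L → Fin n → Fin q) (hcs : TGood ε cs) (ω : Fin L → ℝ) (hω : IsDist ω) :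
    |radOmegaL ω (fun i j => phiL q ℓ (cs i j)) - fL ℓ (fun _ : Fin q => 1 / (q : ℝ)) ω| ≤ (q : ℝ) ^ L * ε := by
  rw [radOmega_eq hl1 hlq hn ω hω]
  unfold fL
  have : (1 - ∑ u, typeu cs u * maxOmegaL ℓ ω u) -
      (1 - ∑ x : Fin L → Fin q, (∏ _i : Fin L, 1 / (q : ℝ)) * maxOmegaL ℓ ω x) =
      ∑ u, (1 / (q : ℝ) ^ L - typeu cs u) * maxOmegaL ℓ ω u := by
    simp_rw [sub_mul, Finset.sum_sub_distrib]
    simp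
  rw [this]
  refine (Finset.abs_sum_le_sum_abs _ _).trans ?_
  refine (Finset.sum_le_card_nsmul _ _ ε ?_).trans ?_
  · intro u _
    rw [abs_mul]
    have h1 := hcs u
    rw [abs_sub_comm] at h1
    have h2 := maxOmega_bd hlq ω hω u
    nlinarith [abs_nonneg (1 / (q : ℝ) ^ L - typeu cs u), abs_nonneg (maxOmegaL ℓ ω u)]
  · simp

lemma good_inj {q n L : ℕ} (hq : 2 ≤ q) (ε : ℝ) (hε : ε < 1 / (q : ℝ) ^ L)
    (cs : Fin L → Fin n → Fin q) (hcs : TGood ε cs) : Function.Injective cs := by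
  intro a b hab
  by_contra hne
  let u : Fin L → Fin q := fun i => if i = a then ⟨0, by omega⟩ else ⟨1, by omega⟩
  have h := hcs u
  have h0 : typeu cs u = 0 := by
    unfold typeu
    rw [Finset.filter_false_of_mem]
    · simp
    · intro j _ hj
      have h1 := hj a
      have h2 := hj b
      rw [hab, h2] at h1
      simp [u, Ne.symm hne] at h1
  rw [h0, zero_sub, abs_neg, abs_of_nonneg (by positivity)] at h
  linarith

theorem abundance_of_random_like_tuples_list_recovery (q ℓ L : ℕ)
    (hq : 3 ≤ q) (hl1 : 1 ≤ ℓ) (hlq : ℓ < q) (hL : 2 ≤ L) :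
    ∀ ε : ℝ, 0 < ε → ∃ δ : ℝ, 0 < δ ∧ ∀ s : ℕ, 1 ≤ s → ∃ M0 : ℕ, ∃ c : ℝ,
      ∀ n : ℕ, 1 ≤ n → ∀ C : Finset (Fin n → Fin q), M0 ≤ C.card →
        ((∃ C' ⊆ C, s ≤ C'.card ∧ radLCode ℓ C' ≤ 1 - (ℓ : ℝ) / (q : ℝ) - δ) ∨
          (C.card : ℝ) ^ L - c * (C.card : ℝ) ^ (L - 1) ≤
            (((Fintype.piFinset fun _ : Fin L => C).filter fun cs =>
                Function.Injective cs ∧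
                (∀ u : Fin L → Fin q, |typeu cs u - 1 / (q : ℝ) ^ L| ≤ ε) ∧
                (∀ ω : Fin L → ℝ, IsDist ω →
                  |radOmegaL ω (fun i j => phiL q ℓ (cs i j)) -
                      fL ℓ (fun _ : Fin q => 1 / (q : ℝ)) ω| ≤ (q : ℝ) ^ L * ε)).card : ℝ)) := by
  intro ε hε
  have hq0 : (0 : ℝ) < q := by exact_mod_cast (by omega : 0 < q)
  have hp : (0 : ℝ) < 1 / (q : ℝ) ^ L := by positivity
  set ε' := min ε (1 / (q : ℝ) ^ L / 2) with hε'
  have h1 : 0 < ε' := lt_min hε (by positivity)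
  have h2 : ε' ≤ ε := min_le_left _ _
  have h3 : ε' < 1 / (q : ℝ) ^ L := lt_of_le_of_lt (min_le_right _ _) (by linarith)
  obtain ⟨δ, hδ, H⟩ := few_bad q ℓ (by omega) hl1 hlq L ε' h1
  refine ⟨δ, hδ, fun s hs => ?_⟩
  obtain ⟨c, Hc⟩ := H s hs
  refine ⟨1, c, fun n hn C hC => ?_⟩
  rcases Hc n hn C with h | hb
  · exact Or.inl h
  right
  have hM : 0 < C.card := hC
  obtain ⟨m, rfl⟩ : ∃ m, L = m + 1 := ⟨L - 1, by omega⟩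
  set N := C.card with hN
  have hb' : ((Fintype.piFinset fun _ : Fin (m+1) => C).filter fun cs => ¬ TGood ε' cs).card ≤ c * N ^ m := by
    apply Nat.le_of_mul_le_mul_right _ hM
    rw [pow_succ, ← mul_assoc] at hb
    exact hb
  have htot := Finset.card_filter_add_card_filter_not (s := Fintype.piFinset fun _ : Fin (m+1) => C) (fun cs => TGood ε' cs)
  have hpi : (Fintype.piFinset fun _ : Fin (m+1) => C).card = N ^ (m + 1) := by simp [hN]
  rw [hpi] at htot
  have hsub : ((Fintype.piFinset fun _ : Fin (m+1) => C).filter fun cs => TGood ε' cs).card ≤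
      ((Fintype.piFinset fun _ : Fin (m+1) => C).filter fun cs =>
                Function.Injective cs ∧
                (∀ u : Fin (m+1) → Fin q, |typeu cs u - 1 / (q : ℝ) ^ (m+1)| ≤ ε) ∧
                (∀ ω : Fin (m+1) → ℝ, IsDist ω →
                  |radOmegaL ω (fun i j => phiL q ℓ (cs i j)) -
                      fL ℓ (fun _ : Fin q => 1 / (q : ℝ)) ω| ≤ (q : ℝ) ^ (m+1) * ε)).card := by
    apply Finset.card_le_card
    intro cs hcs
    rw [Finset.mem_filter] at hcs ⊢
    have hg : TGood ε cs := fun u => (hcs.2 u).trans h2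
    exact ⟨hcs.1, good_inj (by omega) ε' h3 cs hcs.2, hg, fun ω hω => omega_conseq hl1 hlq hn ε cs hg ω hω⟩
  have e1 : N ^ (m+1) ≤ ((Fintype.piFinset fun _ : Fin (m+1) => C).filter fun cs =>
                Function.Injective cs ∧
                (∀ u : Fin (m+1) → Fin q, |typeu cs u - 1 / (q : ℝ) ^ (m+1)| ≤ ε) ∧
                (∀ ω : Fin (m+1) → ℝ, IsDist ω →
                  |radOmegaL ω (fun i j => phiL q ℓ (cs i j)) -
                      fL ℓ (fun _ : Fin q => 1 / (q : ℝ)) ω| ≤ (q : ℝ) ^ (m+1) * ε)).card + c * N ^ m := by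
    omega
  have e2 := (Nat.cast_le (α := ℝ)).mpr e1
  push_cast at e2
  rw [Nat.add_sub_cancel]
  linarith
end
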